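/- arXiv:1605.07757 — 2 statements merged into one kernel-verified Lean document; each statement's English description precedes it below -/
import Mathlib

section
/- Let K have characteristic 2 and let k = 1. In A = A^{1,s}(a,c): (i) if s is even then for every c ∈ K, Z(A)/T₁(A)^⊥ ≅ K[Y]/(Y^{s/2}); (ii) if s is odd and c ≠ 0 then Z(A)/T₁(A)^⊥ ≅ K[Y]/(Y^{(s+1)/2}); (iii) if s is odd, c = 0 and a is not a square in K then Z(A)/T₁(A)^⊥ ≅ K[Y]/(Y^{(s+1)/2}); (iv) if s ≥ 5 is odd, c = 0 and a = b² for some b ∈ K, then Z(A)/T₁(A)^⊥ ≅ K[Y]/(Y^{(s+3)/2}). -/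
namespace QT

/-- The generators of the free algebra: the two vertex idempotents `e1, e2`,
the loops `al` (α at vertex 1) and `et` (η at vertex 2), and the arrows
`be` (β : 1 → 2) and `ga` (γ : 2 → 1). -/
inductive Gen : Type
  | e1 : Gen
  | e2 : Gen
  | al : Gen
  | be : Gen
  | ga : Gen
  | et : Gen

open Gen

/-- Generators as elements of the free algebra. -/
noncomputable def gen (K : Type) [Field K] (g : Gen) : FreeAlgebra K Gen :=
  FreeAlgebra.ι K g

/-- The defining relations of the algebra `A^{k,s}(a,c)`: the path-algebra
relations for the quiver with two vertices, loops α, η and arrows β, γ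
(paths composed left to right), together with the relations
βη = (αβγ)^{k−1}αβ, ηγ = (γαβ)^{k−1}γα, α² = a(βγα)^{k−1}βγ + c(βγα)^k,
γβ = η^{s−1}, α²β = 0, γα² = 0. -/
inductive Rel (K : Type) [Field K] (k s : ℕ) (a c : K) :
    FreeAlgebra K Gen → FreeAlgebra K Gen → Prop
  | idem1 : Rel K k s a c (gen K e1 * gen K e1) (gen K e1)
  | idem2 : Rel K k s a c (gen K e2 * gen K e2) (gen K e2)
  | orth12 : Rel K k s a c (gen K e1 * gen K e2) 0
  | orth21 : Rel K k s a c (gen K e2 * gen K e1) 0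
  | sum_idem : Rel K k s a c (gen K e1 + gen K e2) 1
  | al_left : Rel K k s a c (gen K e1 * gen K al) (gen K al)
  | al_right : Rel K k s a c (gen K al * gen K e1) (gen K al)
  | be_left : Rel K k s a c (gen K e1 * gen K be) (gen K be)
  | be_right : Rel K k s a c (gen K be * gen K e2) (gen K be)
  | ga_left : Rel K k s a c (gen K e2 * gen K ga) (gen K ga)
  | ga_right : Rel K k s a c (gen K ga * gen K e1) (gen K ga)
  | et_left : Rel K k s a c (gen K e2 * gen K et) (gen K et)
  | et_right : Rel K k s a c (gen K et * gen K e2) (gen K et)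
  | rel_beta_eta : Rel K k s a c (gen K be * gen K et)
      ((gen K al * gen K be * gen K ga) ^ (k - 1) * (gen K al * gen K be))
  | rel_eta_gamma : Rel K k s a c (gen K et * gen K ga)
      ((gen K ga * gen K al * gen K be) ^ (k - 1) * (gen K ga * gen K al))
  | rel_alpha_sq : Rel K k s a c (gen K al * gen K al)
      (a • ((gen K be * gen K ga * gen K al) ^ (k - 1) * (gen K be * gen K ga)) +
        c • (gen K be * gen K ga * gen K al) ^ k)
  | rel_gamma_beta : Rel K k s a c (gen K ga * gen K be) ((gen K et) ^ (s - 1))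
  | rel_alpha_sq_beta : Rel K k s a c (gen K al * gen K al * gen K be) 0
  | rel_gamma_alpha_sq : Rel K k s a c (gen K ga * (gen K al * gen K al)) 0

/-- The algebra `A^{k,s}(a,c)` of quaternion type with two simple modules. -/
abbrev Aa (K : Type) [Field K] (k s : ℕ) (a c : K) : Type :=
  RingQuot (Rel K k s a c)

variable (K : Type) [Field K] (k s : ℕ) (a c : K)

/-- The idempotent e₁ in `A^{k,s}(a,c)`. -/
noncomputable def E1 : Aa K k s a c := RingQuot.mkAlgHom K (Rel K k s a c) (gen K e1)
/-- The idempotent e₂ in `A^{k,s}(a,c)`. -/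
noncomputable def E2 : Aa K k s a c := RingQuot.mkAlgHom K (Rel K k s a c) (gen K e2)
/-- The loop α in `A^{k,s}(a,c)`. -/
noncomputable def Al : Aa K k s a c := RingQuot.mkAlgHom K (Rel K k s a c) (gen K al)
/-- The arrow β in `A^{k,s}(a,c)`. -/
noncomputable def Be : Aa K k s a c := RingQuot.mkAlgHom K (Rel K k s a c) (gen K be)
/-- The arrow γ in `A^{k,s}(a,c)`. -/
noncomputable def Ga : Aa K k s a c := RingQuot.mkAlgHom K (Rel K k s a c) (gen K ga)
/-- The loop η in `A^{k,s}(a,c)`. -/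
noncomputable def Et : Aa K k s a c := RingQuot.mkAlgHom K (Rel K k s a c) (gen K et)

/-- The commutator subspace [A,A]: the K-subspace spanned by all commutators. -/
noncomputable def comm : Submodule K (Aa K k s a c) :=
  Submodule.span K {z : Aa K k s a c | ∃ u v : Aa K k s a c, z = u * v - v * u}

/-- Index type for the basis B = B₁ ∪ B₂ ∪ B₃ ∪ B₄ of `A^{k,s}(a,c)`. -/
abbrev BIdx (k s : ℕ) : Type :=
  ((Fin k ⊕ Fin k) ⊕ (Fin (k - 1) ⊕ Fin (k + 1))) ⊕
    ((Fin (s + 1) ⊕ Fin (k - 1)) ⊕ ((Fin k ⊕ Fin k) ⊕ (Fin k ⊕ Fin k)))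

/-- The family of elements of `A^{k,s}(a,c)` given by
B₁ = {α(βγα)^n, (βγα)^nβγ : 0 ≤ n ≤ k−1} ∪ {(βγα)^m : 1 ≤ m ≤ k−1} ∪ {(αβγ)^ℓ : 0 ≤ ℓ ≤ k},
B₂ = {η^t : 0 ≤ t ≤ s} ∪ {(γαβ)^m : 1 ≤ m ≤ k−1},
B₃ = {(βγα)^nβ, α(βγα)^nβ : 0 ≤ n ≤ k−1},
B₄ = {(γαβ)^nγ, (γαβ)^nγα : 0 ≤ n ≤ k−1}. -/
noncomputable def bVec : BIdx k s → Aa K k s a c := fun i =>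
  let α := Al K k s a c
  let β := Be K k s a c
  let γ := Ga K k s a c
  let η := Et K k s a c
  match i with
  | .inl (.inl (.inl n)) => α * (β * γ * α) ^ (n : ℕ)
  | .inl (.inl (.inr n)) => (β * γ * α) ^ (n : ℕ) * (β * γ)
  | .inl (.inr (.inl m)) => (β * γ * α) ^ ((m : ℕ) + 1)
  | .inl (.inr (.inr l)) => (α * β * γ) ^ (l : ℕ)
  | .inr (.inl (.inl t)) => η ^ (t : ℕ)
  | .inr (.inl (.inr m)) => (γ * α * β) ^ ((m : ℕ) + 1)
  | .inr (.inr (.inl (.inl n))) => (β * γ * α) ^ (n : ℕ) * β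
  | .inr (.inr (.inl (.inr n))) => α * (β * γ * α) ^ (n : ℕ) * β
  | .inr (.inr (.inr (.inl n))) => (γ * α * β) ^ (n : ℕ) * γ
  | .inr (.inr (.inr (.inr n))) => (γ * α * β) ^ (n : ℕ) * (γ * α)

/-- `ψ` is the linear form on `A^{k,s}(a,c)` sending η^s and (αβγ)^k to 1 and every
other element of the basis B to 0. -/
noncomputable def IsPsi (ψ : Aa K k s a c →ₗ[K] K) : Prop :=
  ψ ((Et K k s a c) ^ s) = 1 ∧
  ψ ((Al K k s a c * Be K k s a c * Ga K k s a c) ^ k) = 1 ∧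
  ∀ i : BIdx k s, bVec K k s a c i ≠ (Et K k s a c) ^ s →
    bVec K k s a c i ≠ (Al K k s a c * Be K k s a c * Ga K k s a c) ^ k →
    ψ (bVec K k s a c i) = 0

/-- The set T₁(A) = {x ∈ A : x² ∈ [A,A]} (characteristic 2). -/
noncomputable def T1 : Set (Aa K k s a c) :=
  {z : Aa K k s a c | z ^ 2 ∈ comm K k s a c}

/-- The orthogonal space T₁(A)^⊥ of T₁(A) with respect to the symmetrising form
⟨u,v⟩ = ψ(uv): the space of all z with ψ(z·m) = 0 for all m ∈ T₁(A). -/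
noncomputable def perp (ψ : Aa K k s a c →ₗ[K] K) : Submodule K (Aa K k s a c) :=
  ⨅ m ∈ T1 K k s a c, LinearMap.ker (ψ ∘ₗ LinearMap.mulRight K m)

end QT

set_option synthInstance.maxHeartbeats 1000000

namespace QT

noncomputable instance centerCommRing (K : Type) [Field K] (k s : ℕ) (a c : K) :
    CommRing (Subalgebra.center K (Aa K k s a c)) := inferInstance

noncomputable instance centerAlgebra (K : Type) [Field K] (k s : ℕ) (a c : K) :
    Algebra K (Subalgebra.center K (Aa K k s a c)) := inferInstance

end QT


namespace QT
open Polynomial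

structure QRep (K : Type) [Field K] (s : ℕ) (a c : K) (B : Type) [Ring B] [Algebra K B] where
  e1 : B
  e2 : B
  al : B
  be : B
  ga : B
  et : B
  idem1 : e1 * e1 = e1
  idem2 : e2 * e2 = e2
  orth12 : e1 * e2 = 0
  orth21 : e2 * e1 = 0
  sum_idem : e1 + e2 = 1
  al_left : e1 * al = al
  al_right : al * e1 = al
  be_left : e1 * be = be
  be_right : be * e2 = be
  ga_left : e2 * ga = ga
  ga_right : ga * e1 = ga
  et_left : e2 * et = et
  et_right : et * e2 = et
  beta_eta : be * et = al * be
  eta_gamma : et * ga = ga * al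
  alpha_sq : al * al = a • (be * ga) + c • (be * ga * al)
  gamma_beta : ga * be = et ^ (s - 1)
  alpha_sq_beta : al * al * be = 0
  gamma_alpha_sq : ga * (al * al) = 0

namespace QRep
variable {K : Type} [Field K] {s : ℕ} {a c : K} {B : Type} [Ring B] [Algebra K B]
  (r : QRep K s a c B)

noncomputable def el (p q m n : K[X]) : B :=
  r.e1 * aeval r.al p + r.e2 * aeval r.et q + aeval r.al m * r.be + r.ga * aeval r.al n

lemma be_e1 : r.be * r.e1 = 0 := by rw [← r.be_right, mul_assoc, r.orth21, mul_zero]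
lemma e2_be : r.e2 * r.be = 0 := by rw [← r.be_left, ← mul_assoc, r.orth21, zero_mul]
lemma ga_e2 : r.ga * r.e2 = 0 := by rw [← r.ga_right, mul_assoc, r.orth12, mul_zero]
lemma e1_ga : r.e1 * r.ga = 0 := by rw [← r.ga_left, ← mul_assoc, r.orth12, zero_mul]

lemma comm_aeval {x y : B} (h : x * y = y * x) (p : K[X]) : x * aeval y p = aeval y p * x := by
  induction p using Polynomial.induction_on' with
  | add p q hp hq => simp [mul_add, add_mul, hp, hq]
  | monomial n t =>
    have : Commute x (y ^ n) := Commute.pow_right h n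
    simp only [aeval_monomial]
    rw [← mul_assoc, ← Algebra.commutes t x, mul_assoc, this.eq, mul_assoc]

lemma inter_aeval {x y z : B} (h : x * y = z * x) (p : K[X]) : x * aeval y p = aeval z p * x := by
  induction p using Polynomial.induction_on' with
  | add p q hp hq => simp [mul_add, add_mul, hp, hq]
  | monomial n t =>
    have : SemiconjBy x (y ^ n) (z ^ n) := SemiconjBy.pow_right h n
    simp only [aeval_monomial]
    rw [← mul_assoc, ← Algebra.commutes t x, mul_assoc, this.eq, mul_assoc]

lemma e1_al (p : K[X]) : r.e1 * aeval r.al p = aeval r.al p * r.e1 :=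
  inter_aeval (by rw [r.al_left, r.al_right]) p
lemma e2_et (p : K[X]) : r.e2 * aeval r.et p = aeval r.et p * r.e2 :=
  inter_aeval (by rw [r.et_left, r.et_right]) p
lemma be_et (p : K[X]) : r.be * aeval r.et p = aeval r.al p * r.be :=
  inter_aeval r.beta_eta p
lemma ga_al (p : K[X]) : r.ga * aeval r.al p = aeval r.et p * r.ga :=
  inter_aeval r.eta_gamma.symm p

variable (a c) in
noncomputable def w : K[X] := C a⁻¹ * X ^ 2 - C (c * a⁻¹ * a⁻¹) * X ^ 3

lemma al_cube : r.al ^ 3 = a • (r.be * r.ga * r.al) := by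
  have : r.al ^ 3 = (r.al * r.al) * r.al := by noncomm_ring
  rw [this, r.alpha_sq, add_mul, smul_mul_assoc, smul_mul_assoc, mul_assoc (r.be * r.ga),
    mul_assoc r.be r.ga (r.al * r.al), r.gamma_alpha_sq]
  simp

lemma be_ga (ha : a ≠ 0) : r.be * r.ga = r.e1 * aeval r.al (w a c) := by
  have h : aeval r.al (w a c) = r.be * r.ga := by
    simp only [w, map_sub, ← smul_eq_C_mul, map_smul, map_pow, aeval_X, r.al_cube]
    rw [sq, r.alpha_sq]
    simp only [smul_add, smul_smul]
    rw [inv_mul_cancel₀ ha, one_smul, mul_assoc (c * a⁻¹), inv_mul_cancel₀ ha, mul_one,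
      mul_comm a⁻¹ c]
    abel
  rw [h, ← mul_assoc, r.be_left]

lemma al_four : r.al ^ 4 = 0 := by
  have : r.al ^ 4 = (r.al ^ 3) * r.al := by noncomm_ring
  rw [this, r.al_cube, smul_mul_assoc, mul_assoc (r.be * r.ga), mul_assoc r.be, r.gamma_alpha_sq]
  simp

lemma et_top (hs : 3 ≤ s) : r.et ^ (s + 1) = 0 := by
  have : r.et ^ (s + 1) = r.et * r.et ^ (s - 1) * r.et := by
    rw [← pow_succ', ← pow_succ]; congr 1; omega
  rw [this, ← r.gamma_beta, ← mul_assoc, r.eta_gamma, mul_assoc, r.beta_eta, mul_assoc,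
    ← mul_assoc r.al, r.alpha_sq_beta, mul_zero]

lemma el_zero (hs : 3 ≤ s) {p q m n : K[X]} (hp : X ^ 4 ∣ p) (hq : X ^ (s + 1) ∣ q)
    (hm : X ^ 2 ∣ m) (hn : X ^ 2 ∣ n) : r.el p q m n = 0 := by
  obtain ⟨p, rfl⟩ := hp
  obtain ⟨q, rfl⟩ := hq
  obtain ⟨m, rfl⟩ := hm
  obtain ⟨n, rfl⟩ := hn
  rw [mul_comm _ m]
  simp only [el, map_mul, map_pow, aeval_X, r.al_four, r.et_top hs, mul_assoc]
  rw [sq, r.alpha_sq_beta, ← mul_assoc r.ga, r.gamma_alpha_sq]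
  simp

lemma el_add (p q m n p' q' m' n' : K[X]) :
    r.el p q m n + r.el p' q' m' n' = r.el (p + p') (q + q') (m + m') (n + n') := by
  simp only [el, map_add, mul_add, add_mul]; abel
lemma el_sub (p q m n p' q' m' n' : K[X]) :
    r.el p q m n - r.el p' q' m' n' = r.el (p - p') (q - q') (m - m') (n - n') := by
  simp only [el, map_sub, mul_sub, sub_mul]; abel
lemma el_smul (t : K) (p q m n : K[X]) :
    t • r.el p q m n = r.el (C t * p) (C t * q) (C t * m) (C t * n) := by
  simp only [el, map_mul, aeval_C, ← Algebra.smul_def, smul_add, smul_mul_assoc, mul_smul_comm]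
lemma el_one : r.el 1 1 0 0 = 1 := by simp [el, r.sum_idem]
lemma el_C (t : K) : r.el (C t) (C t) 0 0 = algebraMap K B t := by
  have := r.el_smul t 1 1 0 0
  rw [el_one] at this
  rw [Algebra.algebraMap_eq_smul_one, this]; simp

lemma el_mul (ha : a ≠ 0) (p q m n p' q' m' n' : K[X]) :
    r.el p q m n * r.el p' q' m' n' =
      r.el (p * p' + m * n' * w a c) (q * q' + n * m' * X ^ (s - 1))
        (p * m' + m * q') (n * p' + q * n') := by
  have h11 : (r.e1 * aeval r.al p) * (r.e1 * aeval r.al p') = r.e1 * aeval r.al (p * p') := by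
    rw [map_mul, r.e1_al, mul_assoc, ← mul_assoc r.e1 r.e1, r.idem1, ← mul_assoc, ← r.e1_al,
      mul_assoc]
  have h12 : (r.e1 * aeval r.al p) * (r.e2 * aeval r.et q') = 0 := by
    rw [r.e1_al, mul_assoc, ← mul_assoc r.e1 r.e2, r.orth12, zero_mul, mul_zero]
  have h13 : (r.e1 * aeval r.al p) * (aeval r.al m' * r.be) = aeval r.al (p * m') * r.be := by
    rw [mul_assoc, ← mul_assoc (aeval r.al p), ← map_mul, ← mul_assoc, r.e1_al, mul_assoc,
      r.be_left]
  have h14 : (r.e1 * aeval r.al p) * (r.ga * aeval r.al n') = 0 := by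
    rw [r.e1_al, mul_assoc, ← mul_assoc r.e1, r.e1_ga, zero_mul, mul_zero]
  have h21 : (r.e2 * aeval r.et q) * (r.e1 * aeval r.al p') = 0 := by
    rw [r.e2_et, mul_assoc, ← mul_assoc r.e2, r.orth21, zero_mul, mul_zero]
  have h22 : (r.e2 * aeval r.et q) * (r.e2 * aeval r.et q') = r.e2 * aeval r.et (q * q') := by
    rw [map_mul, r.e2_et, mul_assoc, ← mul_assoc r.e2 r.e2, r.idem2, ← mul_assoc, ← r.e2_et,
      mul_assoc]
  have h23 : (r.e2 * aeval r.et q) * (aeval r.al m' * r.be) = 0 := by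
    rw [← r.be_et, r.e2_et, mul_assoc, ← mul_assoc r.e2, r.e2_be, zero_mul, mul_zero]
  have h24 : (r.e2 * aeval r.et q) * (r.ga * aeval r.al n') = r.ga * aeval r.al (q * n') := by
    rw [r.e2_et, mul_assoc, ← mul_assoc r.e2, r.ga_left, ← mul_assoc, ← r.ga_al, mul_assoc,
      ← map_mul]
  have h31 : (aeval r.al m * r.be) * (r.e1 * aeval r.al p') = 0 := by
    rw [mul_assoc, ← mul_assoc r.be, r.be_e1, zero_mul, mul_zero]
  have h32 : (aeval r.al m * r.be) * (r.e2 * aeval r.et q') = aeval r.al (m * q') * r.be := by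
    rw [mul_assoc, ← mul_assoc r.be, r.be_right, r.be_et, ← mul_assoc, ← map_mul]
  have h33 : (aeval r.al m * r.be) * (aeval r.al m' * r.be) = 0 := by
    rw [← r.be_left, ← mul_assoc (aeval r.al m'), ← r.e1_al, r.be_left, mul_assoc,
      ← mul_assoc r.be, ← mul_assoc r.be, r.be_e1, zero_mul, zero_mul, mul_zero]
  have h34 : (aeval r.al m * r.be) * (r.ga * aeval r.al n')
      = r.e1 * aeval r.al (m * n' * w a c) := by
    rw [mul_assoc, ← mul_assoc r.be, r.be_ga ha, mul_assoc r.e1, ← map_mul, ← mul_assoc,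
      ← r.e1_al, mul_assoc, ← map_mul]
    congr 2; ring
  have h41 : (r.ga * aeval r.al n) * (r.e1 * aeval r.al p') = r.ga * aeval r.al (n * p') := by
    rw [r.e1_al, mul_assoc, ← mul_assoc (aeval r.al n), ← map_mul, ← r.e1_al, ← mul_assoc,
      r.ga_right]
  have h42 : (r.ga * aeval r.al n) * (r.e2 * aeval r.et q') = 0 := by
    rw [r.ga_al, mul_assoc, ← mul_assoc r.ga, r.ga_e2, zero_mul, mul_zero]
  have h43 : (r.ga * aeval r.al n) * (aeval r.al m' * r.be)
      = r.e2 * aeval r.et (n * m' * X ^ (s - 1)) := by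
    rw [mul_assoc, ← mul_assoc (aeval r.al n), ← map_mul, ← r.be_et, ← mul_assoc, r.gamma_beta,
      map_mul _ _ (X ^ (s - 1)), map_pow, aeval_X, ← mul_assoc, r.e2_et, ← r.gamma_beta,
      mul_assoc _ r.e2, ← mul_assoc r.e2, r.ga_left, ← mul_assoc, r.gamma_beta]
    rw [mul_assoc (aeval r.et (n * m')), r.gamma_beta,
      show r.et ^ (s - 1) = aeval r.et ((X : K[X]) ^ (s - 1)) by simp, ← map_mul, ← map_mul,
      mul_comm]
  have h44 : (r.ga * aeval r.al n) * (r.ga * aeval r.al n') = 0 := by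
    rw [r.ga_al n, mul_assoc, ← mul_assoc r.ga, ← r.ga_left, ← mul_assoc (r.e2 * r.ga), r.ga_left,
      r.ga_e2, zero_mul, zero_mul, mul_zero]
  simp only [el, mul_add, add_mul, h11, h12, h13, h14, h21, h22, h23, h24, h31, h32, h33, h34,
    h41, h42, h43, h44, map_add]
  abel

end QRep

/-- the universal representation -/
noncomputable def uni (K : Type) [Field K] (s : ℕ) (a c : K) : QRep K s a c (Aa K 1 s a c) where
  e1 := E1 K 1 s a c
  e2 := E2 K 1 s a c
  al := Al K 1 s a c
  be := Be K 1 s a c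
  ga := Ga K 1 s a c
  et := Et K 1 s a c
  idem1 := by simpa [E1, E2, Al, Be, Ga, Et] using RingQuot.mkAlgHom_rel K (Rel.idem1 (K := K) (k := 1) (s := s) (a := a) (c := c))
  idem2 := by simpa [E1, E2, Al, Be, Ga, Et] using RingQuot.mkAlgHom_rel K (Rel.idem2 (K := K) (k := 1) (s := s) (a := a) (c := c))
  orth12 := by simpa [E1, E2, Al, Be, Ga, Et] using RingQuot.mkAlgHom_rel K (Rel.orth12 (K := K) (k := 1) (s := s) (a := a) (c := c))
  orth21 := by simpa [E1, E2, Al, Be, Ga, Et] using RingQuot.mkAlgHom_rel K (Rel.orth21 (K := K) (k := 1) (s := s) (a := a) (c := c))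
  sum_idem := by simpa [E1, E2, Al, Be, Ga, Et] using RingQuot.mkAlgHom_rel K (Rel.sum_idem (K := K) (k := 1) (s := s) (a := a) (c := c))
  al_left := by simpa [E1, E2, Al, Be, Ga, Et] using RingQuot.mkAlgHom_rel K (Rel.al_left (K := K) (k := 1) (s := s) (a := a) (c := c))
  al_right := by simpa [E1, E2, Al, Be, Ga, Et] using RingQuot.mkAlgHom_rel K (Rel.al_right (K := K) (k := 1) (s := s) (a := a) (c := c))
  be_left := by simpa [E1, E2, Al, Be, Ga, Et] using RingQuot.mkAlgHom_rel K (Rel.be_left (K := K) (k := 1) (s := s) (a := a) (c := c))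
  be_right := by simpa [E1, E2, Al, Be, Ga, Et] using RingQuot.mkAlgHom_rel K (Rel.be_right (K := K) (k := 1) (s := s) (a := a) (c := c))
  ga_left := by simpa [E1, E2, Al, Be, Ga, Et] using RingQuot.mkAlgHom_rel K (Rel.ga_left (K := K) (k := 1) (s := s) (a := a) (c := c))
  ga_right := by simpa [E1, E2, Al, Be, Ga, Et] using RingQuot.mkAlgHom_rel K (Rel.ga_right (K := K) (k := 1) (s := s) (a := a) (c := c))
  et_left := by simpa [E1, E2, Al, Be, Ga, Et] using RingQuot.mkAlgHom_rel K (Rel.et_left (K := K) (k := 1) (s := s) (a := a) (c := c))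
  et_right := by simpa [E1, E2, Al, Be, Ga, Et] using RingQuot.mkAlgHom_rel K (Rel.et_right (K := K) (k := 1) (s := s) (a := a) (c := c))
  beta_eta := by simpa [E1, E2, Al, Be, Ga, Et] using RingQuot.mkAlgHom_rel K (Rel.rel_beta_eta (K := K) (k := 1) (s := s) (a := a) (c := c))
  eta_gamma := by simpa [E1, E2, Al, Be, Ga, Et] using RingQuot.mkAlgHom_rel K (Rel.rel_eta_gamma (K := K) (k := 1) (s := s) (a := a) (c := c))
  alpha_sq := by simpa [E1, E2, Al, Be, Ga, Et] using RingQuot.mkAlgHom_rel K (Rel.rel_alpha_sq (K := K) (k := 1) (s := s) (a := a) (c := c))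
  gamma_beta := by simpa [E1, E2, Al, Be, Ga, Et] using RingQuot.mkAlgHom_rel K (Rel.rel_gamma_beta (K := K) (k := 1) (s := s) (a := a) (c := c))
  alpha_sq_beta := by simpa [E1, E2, Al, Be, Ga, Et] using RingQuot.mkAlgHom_rel K (Rel.rel_alpha_sq_beta (K := K) (k := 1) (s := s) (a := a) (c := c))
  gamma_alpha_sq := by simpa [E1, E2, Al, Be, Ga, Et] using RingQuot.mkAlgHom_rel K (Rel.rel_gamma_alpha_sq (K := K) (k := 1) (s := s) (a := a) (c := c))

namespace QRep
variable {K : Type} [Field K] {s : ℕ} {a c : K} {B : Type} [Ring B] [Algebra K B]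
  (r : QRep K s a c B)

def val : Gen → B
  | .e1 => r.e1
  | .e2 => r.e2
  | .al => r.al
  | .be => r.be
  | .ga => r.ga
  | .et => r.et

noncomputable def lift : Aa K 1 s a c →ₐ[K] B :=
  RingQuot.liftAlgHom K ⟨FreeAlgebra.lift K r.val, by
    intro x y h
    induction h <;> simp only [gen, map_mul, map_add, map_smul, map_pow, map_one, map_zero,
      FreeAlgebra.lift_ι_apply, val, Nat.sub_self, pow_zero, one_mul, pow_one]
    · exact r.idem1
    · exact r.idem2
    · exact r.orth12
    · exact r.orth21
    · exact r.sum_idem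
    · exact r.al_left
    · exact r.al_right
    · exact r.be_left
    · exact r.be_right
    · exact r.ga_left
    · exact r.ga_right
    · exact r.et_left
    · exact r.et_right
    · exact r.beta_eta
    · exact r.eta_gamma
    · exact r.alpha_sq
    · exact r.gamma_beta
    · exact r.alpha_sq_beta
    · exact r.gamma_alpha_sq⟩

lemma lift_el (p q m n : K[X]) : r.lift ((uni K s a c).el p q m n) = r.el p q m n := by
  have h (g : Gen) : r.lift (RingQuot.mkAlgHom K (Rel K 1 s a c) (gen K g)) = r.val g := by
    simp [lift, gen]
  have h1 : r.lift (uni K s a c).e1 = r.e1 := h .e1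
  have h2 : r.lift (uni K s a c).e2 = r.e2 := h .e2
  have h3 : r.lift (uni K s a c).al = r.al := h .al
  have h4 : r.lift (uni K s a c).be = r.be := h .be
  have h5 : r.lift (uni K s a c).ga = r.ga := h .ga
  have h6 : r.lift (uni K s a c).et = r.et := h .et
  simp only [el, map_add, map_mul, ← aeval_algHom_apply, h1, h2, h3, h4, h5, h6]

section mod
variable {U V : Type} [AddCommGroup U] [AddCommGroup V] [Module K U] [Module K V]
  [Module K[X] U] [Module K[X] V] [IsScalarTower K K[X] U] [IsScalarTower K K[X] V]

noncomputable def ofMod (hs : 3 ≤ s) (b : V →ₗ[K[X]] U) (g : U →ₗ[K[X]] V)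
    (hx : ∀ u : U, (X ^ 2 : K[X]) • u = a • b (g u) + c • b (g ((X : K[X]) • u)))
    (hg : ∀ v : V, g (b v) = (X ^ (s - 1) : K[X]) • v)
    (h1 : ∀ v : V, (X ^ 2 : K[X]) • b v = 0) (h2 : ∀ u : U, g ((X ^ 2 : K[X]) • u) = 0) :
    QRep K s a c (Module.End K (U × V)) where
  e1 := (LinearMap.inl K U V) ∘ₗ (LinearMap.fst K U V)
  e2 := (LinearMap.inr K U V) ∘ₗ (LinearMap.snd K U V)
  al := (LinearMap.inl K U V) ∘ₗ (Algebra.lsmul K K U (X : K[X])) ∘ₗ (LinearMap.fst K U V)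
  et := (LinearMap.inr K U V) ∘ₗ (Algebra.lsmul K K V (X : K[X])) ∘ₗ (LinearMap.snd K U V)
  be := (LinearMap.inl K U V) ∘ₗ (b.restrictScalars K) ∘ₗ (LinearMap.snd K U V)
  ga := (LinearMap.inr K U V) ∘ₗ (g.restrictScalars K) ∘ₗ (LinearMap.fst K U V)
  idem1 := by ext <;> simp
  idem2 := by ext <;> simp
  orth12 := by ext <;> simp
  orth21 := by ext <;> simp
  sum_idem := by ext <;> simp
  al_left := by ext <;> simp
  al_right := by ext <;> simp
  be_left := by ext <;> simp
  be_right := by ext <;> simp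
  ga_left := by ext <;> simp
  ga_right := by ext <;> simp
  et_left := by ext <;> simp
  et_right := by ext <;> simp
  beta_eta := by ext <;> simp
  eta_gamma := by ext <;> simp
  alpha_sq := by
    ext u
    · have := hx u
      simp only [sq, mul_smul, map_smul] at this
      simp [this]
    all_goals simp
  gamma_beta := by
    have hp : ∀ i : ℕ, 0 < i → ∀ z : U × V, (((LinearMap.inr K U V) ∘ₗ
        (Algebra.lsmul K K V (X : K[X])) ∘ₗ (LinearMap.snd K U V) : Module.End K (U × V)) ^ i) z
        = (0, (X ^ i : K[X]) • z.2) := by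
      intro i hi
      induction i, hi using Nat.le_induction with
      | base => intro z; simp
      | succ i hi ih =>
        intro z
        rw [pow_succ', Module.End.mul_apply, ih]
        simp [pow_succ', mul_smul]
    refine LinearMap.ext fun z => ?_
    rw [hp (s - 1) (by omega), ← hg]
    simp
  alpha_sq_beta := by
    ext u
    · simp
    · simp
    · have := h1 u
      simp only [sq, mul_smul] at this
      simpa using this
    · simp
  gamma_alpha_sq := by
    ext u
    · simp
    · have := h2 u
      simp only [sq, mul_smul, map_smul] at this
      simpa using this
    all_goals simp

end mod

end QRep
end QT

namespace QT
open Polynomial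
namespace QRep
section mod2
variable {K : Type} [Field K] {s : ℕ} {a c : K}
  {U V : Type} [AddCommGroup U] [AddCommGroup V] [Module K U] [Module K V]
  [Module K[X] U] [Module K[X] V] [IsScalarTower K K[X] U] [IsScalarTower K K[X] V]

lemma ofMod_apply (hs : 3 ≤ s) (b : V →ₗ[K[X]] U) (g : U →ₗ[K[X]] V)
    (hx : ∀ u : U, (X ^ 2 : K[X]) • u = a • b (g u) + c • b (g ((X : K[X]) • u)))
    (hg : ∀ v : V, g (b v) = (X ^ (s - 1) : K[X]) • v)
    (h1 : ∀ v : V, (X ^ 2 : K[X]) • b v = 0) (h2 : ∀ u : U, g ((X ^ 2 : K[X]) • u) = 0)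
    (p q m n : K[X]) (u : U) (v : V) :
    (ofMod (a := a) (c := c) hs b g hx hg h1 h2).el p q m n (u, v) =
      (p • u + m • b v, q • v + n • g u) := by
  set r := ofMod (a := a) (c := c) hs b g hx hg h1 h2 with hr
  have hal : ∀ (p : K[X]) (u : U), (aeval r.al p) (u, (0 : V)) = (p • u, 0) := by
    intro p
    induction p using Polynomial.induction_on with
    | C t => intro u; simp [Module.algebraMap_end_apply, ← algebraMap_smul K[X] t u]
    | add p q hp hq => intro u; simp [hp, hq, add_smul]
    | monomial n t ih =>
      intro u
      rw [pow_succ, ← mul_assoc, map_mul, Module.End.mul_apply, aeval_X,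
        show r.al (u, (0 : V)) = ((X : K[X]) • u, 0) by simp [hr, ofMod], ih, ← mul_smul]
  have het : ∀ (p : K[X]) (v : V), (aeval r.et p) ((0 : U), v) = (0, p • v) := by
    intro p
    induction p using Polynomial.induction_on with
    | C t => intro u; simp [Module.algebraMap_end_apply, ← algebraMap_smul K[X] t u]
    | add p q hp hq => intro u; simp [hp, hq, add_smul]
    | monomial n t ih =>
      intro u
      rw [pow_succ, ← mul_assoc, map_mul, Module.End.mul_apply, aeval_X,
        show r.et ((0 : U), u) = (0, (X : K[X]) • u) by simp [hr, ofMod], ih, ← mul_smul]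
  have e1 : r.e1 (u, v) = (u, 0) := by simp [hr, ofMod]
  have e2 : r.e2 (u, v) = (0, v) := by simp [hr, ofMod]
  have e3 : r.be (u, v) = (b v, 0) := by simp [hr, ofMod]
  have e4 : r.ga (u, v) = (0, g u) := by simp [hr, ofMod]
  rw [el, r.e1_al, r.e2_et, r.ga_al]
  simp only [LinearMap.add_apply, Module.End.mul_apply, e1, e2, e3, e4, hal, het]
  simp

end mod2

abbrev RQ (K : Type) [Field K] (i : ℕ) : Type :=
  K[X] ⧸ (Submodule.span K[X] {(X : K[X]) ^ i} : Submodule K[X] K[X])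

noncomputable def mulQ (K : Type) [Field K] (i j : ℕ) (f : K[X]) (h : (X : K[X]) ^ j ∣ f * X ^ i) :
    RQ K i →ₗ[K[X]] RQ K j :=
  Submodule.mapQ _ _ (LinearMap.mulLeft K[X] f) (by
    rw [Submodule.span_singleton_le_iff_mem, Submodule.mem_comap]
    exact Ideal.mem_span_singleton.2 h)

lemma mulQ_mk (K : Type) [Field K] (i j : ℕ) (f : K[X]) (h) (u : K[X]) :
    mulQ K i j f h (Submodule.Quotient.mk u) = Submodule.Quotient.mk (f * u) := rfl

lemma mk_zero_iff {K : Type} [Field K] {i : ℕ} {u : K[X]} :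
    (Submodule.Quotient.mk u : RQ K i) = 0 ↔ X ^ i ∣ u := by
  rw [Submodule.Quotient.mk_eq_zero]; exact Ideal.mem_span_singleton

lemma mk_eq_iff {K : Type} [Field K] {i : ℕ} {u v : K[X]} :
    (Submodule.Quotient.mk u : RQ K i) = Submodule.Quotient.mk v ↔ X ^ i ∣ u - v := by
  rw [← mk_zero_iff, Submodule.Quotient.mk_sub, sub_eq_zero]

lemma smulK_mk {K : Type} [Field K] {i : ℕ} (t : K) (u : K[X]) :
    t • (Submodule.Quotient.mk u : RQ K i) = Submodule.Quotient.mk (C t * u) := by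
  rw [← smul_eq_C_mul]; rfl

lemma smulX_mk {K : Type} [Field K] {i : ℕ} (t : K[X]) (u : K[X]) :
    t • (Submodule.Quotient.mk u : RQ K i) = Submodule.Quotient.mk (t * u) := rfl

variable {K : Type} [Field K] {s : ℕ} {a c : K}

lemma w_eq (ha : a ≠ 0) : (w a c : K[X]) = X ^ 2 * (C a⁻¹ - C (c * a⁻¹ * a⁻¹) * X) := by
  rw [w]; ring

lemma w_rel (ha : a ≠ 0) : (X : K[X]) ^ 4 ∣ X ^ 2 - (C a * w a c + C c * (w a c * X)) := by
  refine ⟨C (c * c * a⁻¹ * a⁻¹), ?_⟩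
  have h : (C a * C a⁻¹ : K[X]) = 1 := by rw [← C_mul, mul_inv_cancel₀ ha, C_1]
  rw [w]
  simp only [C_mul]
  linear_combination (-X ^ 2 + C c * C a⁻¹ * X ^ 3) * h

noncomputable def rep1 (ha : a ≠ 0) (hs : 3 ≤ s) :
    QRep K s a c (Module.End K (RQ K 4 × RQ K 2)) :=
  ofMod hs (mulQ K 2 4 (w a c) (by rw [w_eq ha]; exact ⟨C a⁻¹ - C (c * a⁻¹ * a⁻¹) * X, by ring⟩))
    (mulQ K 4 2 1 ⟨X ^ 2, by ring⟩)
    (by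
      intro u
      obtain ⟨u, rfl⟩ := Submodule.Quotient.mk_surjective _ u
      simp only [mulQ_mk, smulK_mk, smulX_mk, ← Submodule.Quotient.mk_add, mk_eq_iff]
      convert Dvd.dvd.mul_right (w_rel (c := c) ha) u using 1
      ring)
    (by
      intro u
      obtain ⟨u, rfl⟩ := Submodule.Quotient.mk_surjective _ u
      simp only [mulQ_mk, smulK_mk, smulX_mk, mk_eq_iff]
      refine dvd_sub ?_ (Dvd.dvd.mul_right (pow_dvd_pow _ (by omega)) _)
      rw [w_eq ha]; exact ⟨(C a⁻¹ - C (c * a⁻¹ * a⁻¹) * X) * u, by ring⟩)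
    (by
      intro u
      obtain ⟨u, rfl⟩ := Submodule.Quotient.mk_surjective _ u
      simp only [mulQ_mk, smulK_mk, smulX_mk, mk_zero_iff]
      rw [w_eq ha]; exact ⟨(C a⁻¹ - C (c * a⁻¹ * a⁻¹) * X) * u, by ring⟩)
    (by
      intro u
      obtain ⟨u, rfl⟩ := Submodule.Quotient.mk_surjective _ u
      simp only [mulQ_mk, smulK_mk, smulX_mk, mk_zero_iff]
      exact ⟨u, by ring⟩)

noncomputable def rep2 (ha : a ≠ 0) (hs : 3 ≤ s) :
    QRep K s a c (Module.End K (RQ K 2 × RQ K (s + 1))) :=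
  ofMod hs (mulQ K (s + 1) 2 1 (by rw [one_mul]; exact pow_dvd_pow _ (by omega)))
    (mulQ K 2 (s + 1) (X ^ (s - 1)) (by rw [← pow_add]; exact pow_dvd_pow _ (by omega)))
    (by
      intro u
      obtain ⟨u, rfl⟩ := Submodule.Quotient.mk_surjective _ u
      simp only [mulQ_mk, smulK_mk, smulX_mk, ← Submodule.Quotient.mk_add, mk_eq_iff]
      have : (X : K[X]) ^ 2 ∣ X ^ (s - 1) := pow_dvd_pow _ (by omega)
      refine dvd_sub (dvd_mul_right _ _) (dvd_add ?_ ?_) <;>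
      exact Dvd.dvd.mul_left (Dvd.dvd.mul_left (Dvd.dvd.mul_right this _) _) _)
    (by
      intro u
      obtain ⟨u, rfl⟩ := Submodule.Quotient.mk_surjective _ u
      simp only [mulQ_mk, smulK_mk, smulX_mk, one_mul])
    (by
      intro u
      obtain ⟨u, rfl⟩ := Submodule.Quotient.mk_surjective _ u
      simp only [mulQ_mk, smulK_mk, smulX_mk, mk_zero_iff]
      exact ⟨u, by ring⟩)
    (by
      intro u
      obtain ⟨u, rfl⟩ := Submodule.Quotient.mk_surjective _ u
      simp only [mulQ_mk, smulK_mk, smulX_mk, mk_zero_iff]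
      rw [← mul_assoc, ← pow_add]
      exact Dvd.dvd.mul_right (pow_dvd_pow _ (by omega)) _)

lemma uni_el_zero_iff (ha : a ≠ 0) (hs : 3 ≤ s) {p q m n : K[X]} :
    (uni K s a c).el p q m n = 0 ↔ X ^ 4 ∣ p ∧ X ^ (s + 1) ∣ q ∧ X ^ 2 ∣ m ∧ X ^ 2 ∣ n := by
  constructor
  · intro h
    have h1 := congrArg (rep1 (c := c) ha hs).lift h
    have h2 := congrArg (rep2 (c := c) ha hs).lift h
    rw [lift_el, map_zero] at h1 h2
    have h1 := LinearMap.congr_fun h1 (Submodule.Quotient.mk 1, 0)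
    have h2 := LinearMap.congr_fun h2 (0, Submodule.Quotient.mk 1)
    rw [rep1, ofMod_apply] at h1
    rw [rep2, ofMod_apply] at h2
    simp only [map_zero, smul_zero, add_zero, zero_add, LinearMap.zero_apply, mulQ_mk, smulX_mk,
      mul_one, Prod.mk_eq_zero, mk_zero_iff] at h1 h2
    exact ⟨h1.1, h2.2, h2.1, h1.2⟩
  · rintro ⟨h1, h2, h3, h4⟩
    exact el_zero _ hs h1 h2 h3 h4

lemma exists_el (ha : a ≠ 0) (hs : 3 ≤ s) (z : Aa K 1 s a c) :
    ∃ p q m n, z = (uni K s a c).el p q m n := by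
  obtain ⟨z, rfl⟩ := RingQuot.mkAlgHom_surjective K (Rel K 1 s a c) z
  induction z using FreeAlgebra.induction with
  | grade0 t => exact ⟨C t, C t, 0, 0, by rw [el_C]; simp⟩
  | grade1 g =>
    cases g
    · exact ⟨1, 0, 0, 0, by simp [el, uni]; rfl⟩
    · exact ⟨0, 1, 0, 0, by simp [el, uni]; rfl⟩
    · exact ⟨X, 0, 0, 0, by simp [el, (uni K s a c).al_left]; rfl⟩
    · exact ⟨0, 0, 1, 0, by simp [el, uni]; rfl⟩
    · exact ⟨0, 0, 0, 1, by simp [el, uni]; rfl⟩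
    · exact ⟨0, X, 0, 0, by simp [el, (uni K s a c).et_left]; rfl⟩
  | mul x y hx hy =>
    obtain ⟨p, q, m, n, h⟩ := hx
    obtain ⟨p', q', m', n', h'⟩ := hy
    rw [map_mul, h, h', el_mul _ ha]
    exact ⟨_, _, _, _, rfl⟩
  | add x y hx hy =>
    obtain ⟨p, q, m, n, h⟩ := hx
    obtain ⟨p', q', m', n', h'⟩ := hy
    rw [map_add, h, h', el_add]
    exact ⟨_, _, _, _, rfl⟩

end QRep
end QT

namespace QT
open Polynomial
namespace QRep
variable {K : Type} [Field K] {s : ℕ} {a c : K}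

lemma el_inj (ha : a ≠ 0) (hs : 3 ≤ s) {p q m n p' q' m' n' : K[X]}
    (h : (uni K s a c).el p q m n = (uni K s a c).el p' q' m' n') :
    (∀ i < 4, p.coeff i = p'.coeff i) ∧ (∀ i < s + 1, q.coeff i = q'.coeff i) ∧
    (∀ i < 2, m.coeff i = m'.coeff i) ∧ (∀ i < 2, n.coeff i = n'.coeff i) := by
  rw [← sub_eq_zero, el_sub, uni_el_zero_iff ha hs] at h
  simpa only [X_pow_dvd_iff, coeff_sub, sub_eq_zero] using h

lemma coeff_mul_w (u : K[X]) : (u * w a c).coeff 0 = 0 ∧ (u * w a c).coeff 1 = 0 ∧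
    (u * w a c).coeff 2 = u.coeff 0 * a⁻¹ ∧
    (u * w a c).coeff 3 = u.coeff 1 * a⁻¹ - u.coeff 0 * (c * a⁻¹ * a⁻¹) := by
  have : u * w a c = u * C a⁻¹ * X ^ 2 - u * C (c * a⁻¹ * a⁻¹) * X ^ 3 := by rw [w]; ring
  rw [this]
  simp only [coeff_sub, coeff_mul_X_pow', coeff_mul_C]
  norm_num

lemma el_al : (uni K s a c).el X 0 0 0 = (uni K s a c).al := by
  simp [el, (uni K s a c).al_left]
lemma el_be : (uni K s a c).el 0 0 1 0 = (uni K s a c).be := by simp [el]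
lemma el_albe : (uni K s a c).el 0 0 X 0 = (uni K s a c).al * (uni K s a c).be := by simp [el]
lemma el_ga : (uni K s a c).el 0 0 0 1 = (uni K s a c).ga := by simp [el]
lemma el_gaal : (uni K s a c).el 0 0 0 X = (uni K s a c).ga * (uni K s a c).al := by simp [el]
lemma e2_et_pow {t : ℕ} (ht : 0 < t) :
    (uni K s a c).e2 * (uni K s a c).et ^ t = (uni K s a c).et ^ t := by
  obtain ⟨t, rfl⟩ : ∃ u, t = u + 1 := ⟨t - 1, by omega⟩
  rw [pow_succ', ← mul_assoc, (uni K s a c).et_left]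
lemma el_et {t : ℕ} (ht : 0 < t) : (uni K s a c).el 0 (X ^ t) 0 0 = (uni K s a c).et ^ t := by
  simp [el, e2_et_pow ht]
lemma el_bega (ha : a ≠ 0) : (uni K s a c).el (w a c) 0 0 0 =
    (uni K s a c).be * (uni K s a c).ga := by
  simp [el, (uni K s a c).be_ga ha]
lemma el_albega (ha : a ≠ 0) : (uni K s a c).el (X * w a c) 0 0 0 =
    (uni K s a c).al * (uni K s a c).be * (uni K s a c).ga := by
  rw [mul_assoc, ← el_bega ha, ← el_al, el_mul _ ha]; simp
lemma begaal : (uni K s a c).be * (uni K s a c).ga * (uni K s a c).al =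
    (uni K s a c).al * (uni K s a c).be * (uni K s a c).ga := by
  rw [mul_assoc, ← (uni K s a c).eta_gamma, ← mul_assoc, (uni K s a c).beta_eta]

lemma psi_aux (ha : a ≠ 0) (hs : 3 ≤ s) {ψ : Aa K 1 s a c →ₗ[K] K} (hψ : IsPsi K 1 s a c ψ)
    (i : BIdx 1 s) {p q m n : K[X]} (h : bVec K 1 s a c i = (uni K s a c).el p q m n)
    (h1 : (∃ j < 4, p.coeff j ≠ 0) ∨ (∃ j < s, q.coeff j ≠ 0) ∨
      (∃ j < 2, m.coeff j ≠ 0) ∨ (∃ j < 2, n.coeff j ≠ 0))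
    (h2 : (∃ j < 3, p.coeff j ≠ 0) ∨ (∃ j < s, q.coeff j ≠ 0) ∨
      (∃ j < 2, m.coeff j ≠ 0) ∨ (∃ j < 2, n.coeff j ≠ 0)) :
    ψ ((uni K s a c).el p q m n) = 0 := by
  rw [← h]
  refine hψ.2.2 i ?_ ?_ <;> rw [h]
  · intro h'
    change _ = (uni K s a c).et ^ s at h'
    rw [← el_et (by omega)] at h'
    obtain ⟨k1, k2, k3, k4⟩ := el_inj ha hs h'
    rcases h1 with ⟨j, hj, h⟩ | ⟨j, hj, h⟩ | ⟨j, hj, h⟩ | ⟨j, hj, h⟩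
    · exact h (by rw [k1 j hj]; simp)
    · exact h (by rw [k2 j (by omega), coeff_X_pow, if_neg (by omega)])
    · exact h (by rw [k3 j hj]; simp)
    · exact h (by rw [k4 j hj]; simp)
  · intro h'
    rw [pow_one] at h'
    change _ = (uni K s a c).al * (uni K s a c).be * (uni K s a c).ga at h'
    rw [← el_albega ha] at h'
    obtain ⟨k1, k2, k3, k4⟩ := el_inj ha hs h'
    rcases h2 with ⟨j, hj, h⟩ | ⟨j, hj, h⟩ | ⟨j, hj, h⟩ | ⟨j, hj, h⟩
    · have := coeff_mul_w (a := a) (c := c) (X : K[X])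
      refine h ?_
      rw [k1 j (by omega)]
      interval_cases j
      · exact this.1
      · exact this.2.1
      · rw [this.2.2.1]; simp
    · exact h (by rw [k2 j (by omega)]; simp)
    · exact h (by rw [k3 j hj]; simp)
    · exact h (by rw [k4 j hj]; simp)

lemma psi_el (ha : a ≠ 0) (hs : 3 ≤ s) {ψ : Aa K 1 s a c →ₗ[K] K} (hψ : IsPsi K 1 s a c ψ)
    (p q m n : K[X]) (hp : p.coeff 0 = 0) (hq : q.coeff 0 = 0) :
    ψ ((uni K s a c).el p q m n) = c * p.coeff 2 + a * p.coeff 3 + q.coeff s := by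
  set r := uni K s a c with hr
  have a1 : ψ r.al = 0 := by
    rw [← el_al]
    refine psi_aux ha hs hψ (.inl (.inl (.inl 0))) (by rw [el_al]; simp [bVec]; rfl) ?_ ?_ <;>
    exact Or.inl ⟨1, by norm_num, by simp⟩
  have a2 : ψ (r.be * r.ga) = 0 := by
    rw [← el_bega ha]
    have := (coeff_mul_w (a := a) (c := c) 1).2.2.1
    rw [one_mul, coeff_one_zero, one_mul] at this
    refine psi_aux ha hs hψ (.inl (.inl (.inr 0))) (by rw [el_bega ha]; simp [bVec]; rfl) ?_ ?_ <;>
    exact Or.inl ⟨2, by norm_num, by rw [this]; exact inv_ne_zero ha⟩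
  have a3 : ψ (r.al * r.be * r.ga) = 1 := by
    have := hψ.2.1
    rw [pow_one] at this
    exact this
  have a4 : ψ (r.al ^ 2) = c := by
    rw [sq, r.alpha_sq, map_add, map_smul, map_smul, a2, begaal, a3]; simp
  have a5 : ψ (r.al ^ 3) = a := by
    rw [r.al_cube, map_smul, begaal, a3]; simp
  have a6 : ψ r.be = 0 := by
    rw [← el_be]
    refine psi_aux ha hs hψ (.inr (.inr (.inl (.inl 0)))) (by rw [el_be]; simp [bVec]; rfl) ?_ ?_ <;>
    exact Or.inr (Or.inr (Or.inl ⟨0, by norm_num, by simp⟩))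
  have a7 : ψ (r.al * r.be) = 0 := by
    rw [← el_albe]
    refine psi_aux ha hs hψ (.inr (.inr (.inl (.inr 0)))) (by rw [el_albe]; simp [bVec]; rfl) ?_ ?_ <;>
    exact Or.inr (Or.inr (Or.inl ⟨1, by norm_num, by simp⟩))
  have a8 : ψ r.ga = 0 := by
    rw [← el_ga]
    refine psi_aux ha hs hψ (.inr (.inr (.inr (.inl 0)))) (by rw [el_ga]; simp [bVec]; rfl) ?_ ?_ <;>
    exact Or.inr (Or.inr (Or.inr ⟨0, by norm_num, by simp⟩))
  have a9 : ψ (r.ga * r.al) = 0 := by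
    rw [← el_gaal]
    refine psi_aux ha hs hψ (.inr (.inr (.inr (.inr 0)))) (by rw [el_gaal]; simp [bVec]; rfl) ?_ ?_ <;>
    exact Or.inr (Or.inr (Or.inr ⟨1, by norm_num, by simp⟩))
  have a10 : ∀ t, 0 < t → t < s → ψ (r.et ^ t) = 0 := by
    intro t h1 h2
    rw [← el_et h1]
    refine psi_aux ha hs hψ (.inr (.inl (.inl ⟨t, by omega⟩))) (by rw [el_et h1]; simp [bVec]; rfl) ?_ ?_ <;>
    exact Or.inr (Or.inl ⟨t, h2, by simp⟩)
  have a11 : ψ (r.et ^ s) = 1 := hψ.1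
  have b1 : ∀ p : K[X], ψ (r.e1 * aeval r.al p) =
      ψ r.e1 * p.coeff 0 + c * p.coeff 2 + a * p.coeff 3 := by
    intro p
    induction p using Polynomial.induction_on' with
    | add p q h1 h2 => simp only [map_add, mul_add, h1, h2, coeff_add]; ring
    | monomial i t =>
      rw [aeval_monomial, ← Algebra.smul_def, mul_smul_comm, map_smul, smul_eq_mul]
      simp only [coeff_monomial]
      rcases i with _ | _ | _ | _ | i
      · simp; ring
      · simp [r.al_left, a1]
      · simp [sq, ← mul_assoc, r.al_left]; rw [← sq, a4]; ring
      · simp [pow_succ', ← mul_assoc, r.al_left]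
        rw [show r.al * r.al * r.al = r.al ^ 3 by noncomm_ring, a5]; ring
      · rw [show i + 1 + 1 + 1 + 1 = 4 + i by omega, pow_add, r.al_four]
        simp
        rw [if_neg (by omega), if_neg (by omega)]; simp
  have b2 : ∀ p : K[X], ψ (r.e2 * aeval r.et p) = ψ r.e2 * p.coeff 0 + p.coeff s := by
    intro p
    induction p using Polynomial.induction_on' with
    | add p q h1 h2 => simp only [map_add, mul_add, h1, h2, coeff_add]; ring
    | monomial i t =>
      rw [aeval_monomial, ← Algebra.smul_def, mul_smul_comm, map_smul, smul_eq_mul]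
      simp only [coeff_monomial]
      rcases Nat.eq_zero_or_pos i with rfl | hi
      · simp [show 0 ≠ s by omega]; ring
      · rw [e2_et_pow hi, if_neg (by omega)]
        rcases lt_trichotomy i s with h | h | h
        · rw [a10 i hi h, if_neg (by omega)]; simp
        · rw [h, a11]; simp
        · rw [show i = (s + 1) + (i - s - 1) by omega, pow_add, ← hr, r.et_top hs, if_neg (by omega)]
          simp
  have b3 : ∀ p : K[X], ψ (aeval r.al p * r.be) = 0 := by
    intro p
    induction p using Polynomial.induction_on' with
    | add p q h1 h2 => simp only [map_add, add_mul, h1, h2, add_zero]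
    | monomial i t =>
      rw [aeval_monomial, ← Algebra.smul_def, smul_mul_assoc, map_smul, smul_eq_mul]
      rcases i with _ | _ | i
      · simp [a6]
      · simp [a7]
      · rw [show i + 1 + 1 = i + 2 by omega, pow_add, mul_assoc, sq, r.alpha_sq_beta]; simp
  have b4 : ∀ p : K[X], ψ (r.ga * aeval r.al p) = 0 := by
    intro p
    induction p using Polynomial.induction_on' with
    | add p q h1 h2 => simp only [map_add, mul_add, h1, h2, add_zero]
    | monomial i t =>
      rw [aeval_monomial, ← Algebra.smul_def, mul_smul_comm, map_smul, smul_eq_mul]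
      rcases i with _ | _ | i
      · simp [a8]
      · simp [a9]
      · rw [show i + 1 + 1 = 2 + i by omega, pow_add, ← mul_assoc, sq, r.gamma_alpha_sq]; simp
  rw [el, map_add, map_add, map_add, b1, b2, b3, b4, hp, hq]
  ring

lemma comm_cond (ha : a ≠ 0) (hs : 3 ≤ s) {p q m n : K[X]}
    (h : (uni K s a c).el p q m n ∈ comm K 1 s a c) :
    p.coeff 0 = 0 ∧ (∀ i < s - 1, q.coeff i = 0) ∧ a * p.coeff 2 + q.coeff (s - 1) = 0 ∧
      c * p.coeff 2 + a * p.coeff 3 + q.coeff s = 0 := by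
  have key : ∀ z ∈ comm K 1 s a c, ∃ p q m n, z = (uni K s a c).el p q m n ∧
      p.coeff 0 = 0 ∧ (∀ i < s - 1, q.coeff i = 0) ∧ a * p.coeff 2 + q.coeff (s - 1) = 0 ∧
      c * p.coeff 2 + a * p.coeff 3 + q.coeff s = 0 := by
    intro z hz
    induction hz using Submodule.span_induction with
    | mem z hz =>
      obtain ⟨u, v, rfl⟩ := hz
      obtain ⟨p, q, m, n, rfl⟩ := exists_el ha hs u
      obtain ⟨p', q', m', n', rfl⟩ := exists_el ha hs v
      rw [el_mul _ ha, el_mul _ ha, el_sub]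
      have e1 : p * p' + m * n' * w a c - (p' * p + m' * n * w a c) =
        (m * n' - m' * n) * w a c := by ring
      have e2 : q * q' + n * m' * X ^ (s - 1) - (q' * q + n' * m * X ^ (s - 1)) =
        -(m * n' - m' * n) * X ^ (s - 1) := by ring
      rw [e1, e2]
      refine ⟨_, _, _, _, rfl, ?_⟩
      generalize m * n' - m' * n = u
      obtain ⟨w0, w1, w2, w3⟩ := coeff_mul_w (a := a) (c := c) u
      refine ⟨w0, fun i hi => ?_, ?_, ?_⟩
      · rw [coeff_mul_X_pow', if_neg (by omega)]
      · rw [w2, coeff_mul_X_pow', if_pos le_rfl, Nat.sub_self, coeff_neg]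
        field_simp; ring
      · rw [w2, w3, coeff_mul_X_pow', if_pos (by omega), show s - (s - 1) = 1 by omega, coeff_neg]
        field_simp; ring
    | zero => exact ⟨0, 0, 0, 0, by simp [el], by simp⟩
    | add x y _ _ hx hy =>
      obtain ⟨p, q, m, n, rfl, h1, h2, h3, h4⟩ := hx
      obtain ⟨p', q', m', n', rfl, h1', h2', h3', h4'⟩ := hy
      refine ⟨_, _, _, _, el_add _ _ _ _ _ _ _ _ _, ?_, fun i hi => ?_, ?_, ?_⟩ <;>
        simp only [coeff_add]
      · rw [h1, h1', add_zero]
      · rw [h2 i hi, h2' i hi, add_zero]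
      · linear_combination h3 + h3'
      · linear_combination h4 + h4'
    | smul t x _ hx =>
      obtain ⟨p, q, m, n, rfl, h1, h2, h3, h4⟩ := hx
      refine ⟨_, _, _, _, el_smul _ _ _ _ _ _, ?_, fun i hi => ?_, ?_, ?_⟩ <;>
        simp only [coeff_C_mul]
      · rw [h1, mul_zero]
      · rw [h2 i hi, mul_zero]
      · linear_combination t * h3
      · linear_combination t * h4
  obtain ⟨p', q', m', n', e, h1, h2, h3, h4⟩ := key _ h
  obtain ⟨k1, k2, -, -⟩ := el_inj ha hs e
  rw [k1 0 (by omega), k1 2 (by omega), k1 3 (by omega), k2 s (by omega), k2 (s - 1) (by omega)]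
  exact ⟨h1, fun i hi => by rw [k2 i (by omega), h2 i hi], h3, h4⟩

lemma coeff_sq_even [CharP K 2] (q : K[X]) (i : ℕ) : (q ^ 2).coeff (2 * i) = q.coeff i ^ 2 := by
  rw [← map_frobenius_expand 2 q, coeff_map, mul_comm, coeff_expand_mul (by norm_num)]; rfl

lemma coeff_sq_odd [CharP K 2] (q : K[X]) (i : ℕ) : (q ^ 2).coeff (2 * i + 1) = 0 := by
  rw [← map_frobenius_expand 2 q, coeff_map, coeff_expand (by norm_num), if_neg (by omega), map_zero]

lemma T1_cond [CharP K 2] (ha : a ≠ 0) (hs : 3 ≤ s) {p q m n : K[X]}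
    (h : (uni K s a c).el p q m n ∈ T1 K 1 s a c) :
    p.coeff 0 = 0 ∧ (∀ i, 2 * i < s - 1 → q.coeff i = 0) ∧
      a * p.coeff 1 ^ 2 + (q ^ 2).coeff (s - 1) = 0 ∧
      c * p.coeff 1 ^ 2 + (q ^ 2).coeff s = 0 := by
  have h : ((uni K s a c).el p q m n) ^ 2 ∈ comm K 1 s a c := h
  rw [sq, el_mul _ ha, mul_comm n m, ← sq, ← sq] at h
  obtain ⟨h1, h2, h3, h4⟩ := comm_cond ha hs h
  generalize m * n = u at *
  obtain ⟨w0, w1, w2, w3⟩ := coeff_mul_w (a := a) (c := c) u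
  have p0 := coeff_sq_even p 0
  have p2 := coeff_sq_even p 1
  have p3 := coeff_sq_odd p 1
  have two : (2 : K) = 0 := CharTwo.two_eq_zero
  norm_num at p0 p2 p3
  rw [coeff_add, w0, p0] at h1
  rw [coeff_add, coeff_add, w2, p2, coeff_mul_X_pow', if_pos le_rfl, Nat.sub_self] at h3
  rw [coeff_add, coeff_add, coeff_add, w2, p2, w3, p3, coeff_mul_X_pow', if_pos (by omega),
    show s - (s - 1) = 1 by omega] at h4
  refine ⟨by simpa using h1, fun i hi => ?_, ?_, ?_⟩
  · have := h2 _ hi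
    rw [coeff_add, coeff_sq_even, coeff_mul_X_pow', if_neg (by omega)] at this
    simpa using this
  · field_simp at h3
    linear_combination h3 - u.coeff 0 * two
  · have hi : a * a⁻¹ = 1 := mul_inv_cancel₀ ha
    linear_combination h4 - (u.coeff 1 - u.coeff 0 * c * a⁻¹) * hi - u.coeff 1 * two

lemma mem_perp {ψ : Aa K 1 s a c →ₗ[K] K} {z : Aa K 1 s a c} :
    z ∈ perp K 1 s a c ψ ↔ ∀ m ∈ T1 K 1 s a c, ψ (z * m) = 0 := by
  simp [perp, Submodule.mem_iInf]

lemma center_el (ha : a ≠ 0) (hs : 3 ≤ s) {z : Aa K 1 s a c}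
    (hz : z ∈ Subalgebra.center K (Aa K 1 s a c)) :
    ∃ P Q, z = (uni K s a c).el P Q 0 0 ∧ X ^ 2 ∣ P - Q := by
  rw [Subalgebra.mem_center_iff] at hz
  obtain ⟨P, Q, M, N, rfl⟩ := exists_el ha hs z
  have h1 := hz ((uni K s a c).el 1 0 0 0)
  have h2 := hz ((uni K s a c).el 0 0 1 0)
  rw [el_mul _ ha, el_mul _ ha] at h1 h2
  obtain ⟨-, -, k1, k2⟩ := el_inj ha hs h1
  obtain ⟨-, -, k3, -⟩ := el_inj ha hs h2
  simp only [one_mul, zero_mul, add_zero, zero_add, mul_one, mul_zero, coeff_zero] at k1 k2 k3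
  refine ⟨P, Q, ?_, X_pow_dvd_iff.2 fun i hi => ?_⟩
  · rw [← sub_eq_zero, el_sub, uni_el_zero_iff ha hs]
    refine ⟨by simp, by simp, X_pow_dvd_iff.2 fun i hi => ?_, X_pow_dvd_iff.2 fun i hi => ?_⟩
    · simpa using k1 i hi
    · simpa using (k2 i hi).symm
  · rw [coeff_sub, k3 i hi, sub_self]

lemma diag_center (ha : a ≠ 0) (hs : 3 ≤ s) (p : K[X]) :
    (uni K s a c).el p p 0 0 ∈ Subalgebra.center K (Aa K 1 s a c) := by
  rw [Subalgebra.mem_center_iff]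
  intro z
  obtain ⟨P, Q, M, N, rfl⟩ := exists_el ha hs z
  rw [el_mul _ ha, el_mul _ ha]
  congr 1 <;> ring

lemma aeval_diag (ha : a ≠ 0) (p : K[X]) :
    aeval ((uni K s a c).el X X 0 0) p = (uni K s a c).el p p 0 0 := by
  induction p using Polynomial.induction_on with
  | C t => rw [aeval_C, el_C]
  | add p q hp hq => rw [map_add, hp, hq, el_add]; simp
  | monomial n t ih =>
    rw [pow_succ, ← mul_assoc, map_mul, ih, aeval_X, el_mul _ ha]; simp

lemma final (ha : a ≠ 0) (hs : 3 ≤ s) (N : ℕ) (ψ : Aa K 1 s a c →ₗ[K] K)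
    (hmem : ∀ p, (uni K s a c).el p p 0 0 ∈ perp K 1 s a c ψ ↔ X ^ N ∣ p)
    (hsurj : ∀ P Q : K[X], X ^ 2 ∣ P - Q → ∃ p,
      (uni K s a c).el P Q 0 0 - (uni K s a c).el p p 0 0 ∈ perp K 1 s a c ψ) :
    ∃ I : Ideal (Subalgebra.center K (Aa K 1 s a c)),
        (∀ z : Subalgebra.center K (Aa K 1 s a c),
          z ∈ I ↔ (z : Aa K 1 s a c) ∈ perp K 1 s a c ψ) ∧
        Nonempty ((Subalgebra.center K (Aa K 1 s a c) ⧸ I) ≃ₐ[K]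
          (Polynomial K ⧸ (Ideal.span {(X : Polynomial K) ^ N}))) := by
  let I : Ideal (Subalgebra.center K (Aa K 1 s a c)) :=
    { carrier := {z | (z : Aa K 1 s a c) ∈ perp K 1 s a c ψ}
      add_mem' := fun {x y} hx hy => Submodule.add_mem (perp K 1 s a c ψ) hx hy
      zero_mem' := Submodule.zero_mem (perp K 1 s a c ψ)
      smul_mem' := by
        intro x z hz
        change ((x * z : Subalgebra.center K (Aa K 1 s a c)) : Aa K 1 s a c) ∈ perp K 1 s a c ψ
        change (z : Aa K 1 s a c) ∈ perp K 1 s a c ψ at hz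
        rw [mem_perp] at hz ⊢
        intro m hm
        have hx := Subalgebra.mem_center_iff.1 x.2
        rw [Subalgebra.coe_mul, ← hx, mul_assoc]
        refine hz _ ?_
        have hc : ∀ (y : Aa K 1 s a c), (∀ b, b * y = y * b) → ∀ u ∈ comm K 1 s a c,
            y * u ∈ comm K 1 s a c := by
          intro y hy u hu
          induction hu using Submodule.span_induction with
          | mem u hu =>
            obtain ⟨u, v, rfl⟩ := hu
            refine Submodule.subset_span ⟨y * u, v, ?_⟩
            rw [mul_sub, ← mul_assoc, ← mul_assoc, ← mul_assoc, hy v]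
          | zero => simp
          | add u v _ _ h1 h2 => rw [mul_add]; exact Submodule.add_mem _ h1 h2
          | smul t u _ h => rw [mul_smul_comm]; exact Submodule.smul_mem _ _ h
        change ((x : Aa K 1 s a c) * m) ^ 2 ∈ comm K 1 s a c
        have e : ((x : Aa K 1 s a c) * m) ^ 2 = x * (x * m ^ 2) := by
          rw [sq, mul_assoc, ← mul_assoc m, hx m, sq]; simp only [mul_assoc]
        rw [e]
        exact hc _ hx _ (hc _ hx _ hm) }
  have hI : ∀ z : Subalgebra.center K (Aa K 1 s a c),
      z ∈ I ↔ (z : Aa K 1 s a c) ∈ perp K 1 s a c ψ := fun z => Iff.rfl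
  refine ⟨I, hI, ?_⟩
  let y : Subalgebra.center K (Aa K 1 s a c) := ⟨_, diag_center ha hs X⟩
  have hy : ∀ p : K[X], ((aeval y p : Subalgebra.center K (Aa K 1 s a c)) : Aa K 1 s a c)
      = (uni K s a c).el p p 0 0 := by
    intro p
    rw [← aeval_diag ha]
    exact (aeval_algHom_apply (Subalgebra.val _) y p).symm
  let f : K[X] →ₐ[K] (Subalgebra.center K (Aa K 1 s a c) ⧸ I) :=
    (Ideal.Quotient.mkₐ K I).comp (aeval y)
  have hf : Function.Surjective f := by
    intro z
    obtain ⟨z, rfl⟩ := Ideal.Quotient.mk_surjective z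
    obtain ⟨P, Q, e, h⟩ := center_el ha hs z.2
    obtain ⟨p, hp⟩ := hsurj P Q h
    refine ⟨p, ?_⟩
    symm
    change Ideal.Quotient.mk I z = Ideal.Quotient.mk I (aeval y p)
    rw [Ideal.Quotient.eq, hI]
    rw [← hy, ← e] at hp
    exact hp
  have hk : RingHom.ker f = Ideal.span {(X : K[X]) ^ N} := by
    ext p
    rw [RingHom.mem_ker, Ideal.mem_span_singleton, ← hmem, ← hy, ← hI]
    exact Ideal.Quotient.eq_zero_iff_mem
  exact ⟨((Ideal.quotientEquivAlgOfEq K hk.symm).trans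
    (Ideal.quotientKerAlgEquivOfSurjective hf)).symm⟩

end QRep
end QT

namespace QT
open Polynomial
namespace QRep
variable {K : Type} [Field K] {s : ℕ} {a c : K}

lemma et_T1 (hs : 3 ≤ s) (ha : a ≠ 0) {j : ℕ} (hj : s + 1 ≤ 2 * j) :
    (uni K s a c).el 0 (X ^ j) 0 0 ∈ T1 K 1 s a c := by
  change ((uni K s a c).el 0 (X ^ j) 0 0) ^ 2 ∈ comm K 1 s a c
  rw [sq, el_mul _ ha]
  rw [(uni_el_zero_iff ha hs).2]
  · exact Submodule.zero_mem _
  · refine ⟨by simp, ?_, by simp, by simp⟩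
    simp only [mul_zero, zero_mul, add_zero]
    rw [← pow_add]; exact pow_dvd_pow _ (by omega)

lemma perp_et (ha : a ≠ 0) (hs : 3 ≤ s) {ψ : Aa K 1 s a c →ₗ[K] K} (hψ : IsPsi K 1 s a c ψ)
    {P Q : K[X]} (h : (uni K s a c).el P Q 0 0 ∈ perp K 1 s a c ψ) {i : ℕ}
    (hi : 2 * i + 1 ≤ s) : Q.coeff i = 0 := by
  have := mem_perp.1 h _ (et_T1 (j := s - i) hs ha (by omega))
  rw [el_mul _ ha, psi_el ha hs hψ] at this
  · simpa [coeff_mul_X_pow', show s - (s - i) = i by omega] using this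
  · simp
  · simp only [mul_zero, zero_mul, add_zero]
    rw [coeff_mul_X_pow', if_neg (by omega)]

lemma simple_case (ha : a ≠ 0) (hs : 3 ≤ s) (N h : ℕ) {ψ : Aa K 1 s a c →ₗ[K] K}
    (hψ : IsPsi K 1 s a c ψ) (hN : 2 ≤ N) (hNh : N + h = s + 1) (hh : s + 1 ≤ 2 * h)
    (hT : ∀ p q m n : K[X], (uni K s a c).el p q m n ∈ T1 K 1 s a c → X ^ 2 ∣ p ∧ X ^ h ∣ q) :
    ∃ I : Ideal (Subalgebra.center K (Aa K 1 s a c)),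
        (∀ z : Subalgebra.center K (Aa K 1 s a c),
          z ∈ I ↔ (z : Aa K 1 s a c) ∈ perp K 1 s a c ψ) ∧
        Nonempty ((Subalgebra.center K (Aa K 1 s a c) ⧸ I) ≃ₐ[K]
          (Polynomial K ⧸ (Ideal.span {(X : Polynomial K) ^ N}))) := by
  have key : ∀ P Q : K[X], X ^ 2 ∣ P - Q →
      ((uni K s a c).el P Q 0 0 ∈ perp K 1 s a c ψ ↔ X ^ N ∣ Q) := by
    intro P Q hPQ
    constructor
    · intro hz
      exact X_pow_dvd_iff.2 fun i hi => perp_et ha hs hψ hz (by omega)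
    · intro hQ
      rw [mem_perp]
      intro z hz
      obtain ⟨p, q, m, n, rfl⟩ := exists_el ha hs z
      obtain ⟨h1, h2⟩ := hT _ _ _ _ hz
      have hQ2 : X ^ 2 ∣ Q := (pow_dvd_pow _ hN).trans hQ
      have hP2 : X ^ 2 ∣ P := by simpa using dvd_add hPQ hQ2
      rw [el_mul _ ha, (uni_el_zero_iff ha hs).2, map_zero]
      simp only [zero_mul, add_zero]
      refine ⟨?_, ?_, hP2.mul_right _, ?_⟩
      · rw [show 4 = 2 + 2 from rfl, pow_add]; exact mul_dvd_mul hP2 h1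
      · rw [← hNh, pow_add]; exact mul_dvd_mul hQ h2
      · rw [zero_add]; exact hQ2.mul_right _
  refine final ha hs N ψ (fun p => key p p (by simp)) fun P Q hPQ => ⟨Q, ?_⟩
  rw [el_sub]
  simp only [sub_zero]
  rw [key _ _ (by simpa using hPQ)]
  simp

lemma last_case [CharP K 2] (ha : a ≠ 0) (h : ℕ) (hh : 2 ≤ h) (b : K) (hb : a = b ^ 2)
    {ψ : Aa K 1 (2 * h + 1) a 0 →ₗ[K] K} (hψ : IsPsi K 1 (2 * h + 1) a 0 ψ) :
    ∃ I : Ideal (Subalgebra.center K (Aa K 1 (2 * h + 1) a 0)),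
        (∀ z : Subalgebra.center K (Aa K 1 (2 * h + 1) a 0),
          z ∈ I ↔ (z : Aa K 1 (2 * h + 1) a 0) ∈ perp K 1 (2 * h + 1) a 0 ψ) ∧
        Nonempty ((Subalgebra.center K (Aa K 1 (2 * h + 1) a 0) ⧸ I) ≃ₐ[K]
          (Polynomial K ⧸ (Ideal.span {(X : Polynomial K) ^ (h + 2)}))) := by
  have hs : 3 ≤ 2 * h + 1 := by omega
  have hb0 : b ≠ 0 := by rintro rfl; simp at hb; exact ha hb
  have key : ∀ P Q : K[X], X ^ 2 ∣ P - Q →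
      ((uni K (2 * h + 1) a 0).el P Q 0 0 ∈ perp K 1 (2 * h + 1) a 0 ψ ↔
        X ^ (h + 1) ∣ Q ∧ a * P.coeff 2 + b * Q.coeff (h + 1) = 0) := by
    intro P Q hPQ
    constructor
    · intro hz
      have h1 : X ^ (h + 1) ∣ Q := X_pow_dvd_iff.2 fun i hi => perp_et ha hs hψ hz (by omega)
      refine ⟨h1, ?_⟩
      have hT : (uni K (2 * h + 1) a 0).el X (C b * X ^ h) 0 0 ∈ T1 K 1 (2 * h + 1) a 0 := by
        change (_ : Aa K 1 (2 * h + 1) a 0) ^ 2 ∈ comm K 1 (2 * h + 1) a 0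
        refine Submodule.subset_span ⟨a • (uni K (2 * h + 1) a 0).be, (uni K (2 * h + 1) a 0).ga, ?_⟩
        rw [← el_be, ← el_ga, el_smul, sq, el_mul _ ha, el_mul _ ha, el_mul _ ha, el_sub]
        have e1 : (C a * w a 0 : K[X]) = X ^ 2 := by
          rw [w]
          simp only [zero_mul, C_0, sub_zero]
          rw [← mul_assoc, ← C_mul, mul_inv_cancel₀ ha]; simp
        have e2 : (2 : K[X]) = 0 := CharTwo.two_eq_zero
        simp only [mul_zero, zero_mul, add_zero, zero_add, mul_one, one_mul, sub_zero, e1, zero_sub]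
        congr 1
        · ring
        · rw [hb, C_pow]; simp only [Nat.add_sub_cancel]
          linear_combination C b ^ 2 * X ^ (2 * h) * e2
      have := mem_perp.1 hz _ hT
      rw [el_mul _ ha, psi_el ha hs hψ] at this
      · simp only [mul_zero, zero_mul, add_zero, zero_add, coeff_mul_X] at this
        rw [show Q * (C b * X ^ h) = C b * Q * X ^ h by ring, coeff_mul_X_pow', if_pos (by omega),
          show 2 * h + 1 - h = h + 1 by omega, coeff_C_mul] at this
        exact this
      · simp
      · simp [show 0 ≠ h by omega]
    · rintro ⟨hQ, hPQ'⟩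
      rw [mem_perp]
      intro z hz
      obtain ⟨p, q, m, n, rfl⟩ := exists_el ha hs z
      obtain ⟨h1, h2, h3, h4⟩ := T1_cond ha hs hz
      have hqb : q.coeff h = b * p.coeff 1 := by
        rw [Nat.add_sub_cancel, coeff_sq_even, hb] at h3
        have : (q.coeff h - b * p.coeff 1) ^ 2 = 0 := by
          have two : (2 : K) = 0 := CharTwo.two_eq_zero
          linear_combination h3 - q.coeff h * b * p.coeff 1 * two
        exact sub_eq_zero.1 (pow_eq_zero_iff two_ne_zero |>.1 this)
      have hQ2 : X ^ 2 ∣ Q := (pow_dvd_pow _ (by omega)).trans hQ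
      have hP2 : X ^ 2 ∣ P := by simpa using dvd_add hPQ hQ2
      obtain ⟨P, rfl⟩ := hP2
      obtain ⟨Q, rfl⟩ := hQ
      obtain ⟨p, rfl⟩ := X_dvd_iff.2 h1
      obtain ⟨q, rfl⟩ : X ^ h ∣ q := X_pow_dvd_iff.2 fun i hi => h2 i (by omega)
      have e1 : X ^ 2 * P * (X * p) = P * p * X ^ 3 := by ring
      have e2 : X ^ (h + 1) * Q * (X ^ h * q) = Q * q * X ^ (2 * h + 1) := by ring
      rw [el_mul _ ha, psi_el ha hs hψ]
      · simp only [mul_zero, zero_mul, add_zero, zero_add, e1, e2]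
        simp only [mul_comm (X ^ _ : K[X]), mul_comm (X : K[X]), coeff_mul_X_pow', coeff_mul_X,
          le_refl, if_true, Nat.sub_self, mul_coeff_zero] at hqb hPQ' ⊢
        linear_combination p.coeff 0 * hPQ' + Q.coeff 0 * hqb
      · simp only [mul_zero, zero_mul, add_zero, zero_add, e1]; simp
      · simp only [mul_zero, zero_mul, add_zero, zero_add, e2]; simp
  refine final ha hs (h + 2) ψ (fun p => ?_) fun P Q hPQ => ?_
  · rw [key p p (by simp)]
    simp only [X_pow_dvd_iff]
    constructor
    · rintro ⟨h1, h2⟩ i hi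
      rcases Nat.lt_succ_iff_lt_or_eq.1 hi with h' | rfl
      · exact h1 i h'
      · rw [h1 2 (by omega)] at h2
        simpa [hb0] using h2
    · intro h1
      exact ⟨fun i hi => h1 i (by omega), by rw [h1 2 (by omega), h1 (h + 1) (by omega)]; simp⟩
  · refine ⟨Q + C (b * (P.coeff 2 - Q.coeff 2)) * X ^ (h + 1), ?_⟩
    rw [el_sub]
    simp only [sub_zero]
    have hX : (X : K[X]) ^ 2 ∣ X ^ (h + 1) := pow_dvd_pow _ (by omega)
    rw [key _ _ (by
      convert hPQ using 1; ring)]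
    constructor
    · exact ⟨-C (b * (P.coeff 2 - Q.coeff 2)), by ring⟩
    · simp only [coeff_sub, coeff_add, coeff_C_mul, coeff_X_pow]
      rw [if_neg (by omega), if_true, hb]
      ring

end QRep
end QT

open QT Polynomial in
/-- char K = 2, k = 1.  In A = A^{1,s}(a,c):
(i) if s is even then for every c, Z(A)/T₁(A)^⊥ ≅ K[Y]/(Y^{s/2});
(ii) if s is odd and c ≠ 0 then Z(A)/T₁(A)^⊥ ≅ K[Y]/(Y^{(s+1)/2});
(iii) if s is odd, c = 0 and a is not a square in K then Z(A)/T₁(A)^⊥ ≅ K[Y]/(Y^{(s+1)/2});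
(iv) if s ≥ 5 is odd, c = 0 and a = b², then Z(A)/T₁(A)^⊥ ≅ K[Y]/(Y^{(s+3)/2}).
The Külshammer ideal T₁^⊥ is realised as the ideal of the centre whose elements are
exactly those central elements lying in the orthogonal space of T₁ with respect to ψ. -/
theorem statement15 (K : Type) [Field K] [CharP K 2] (s : ℕ) (hs : 3 ≤ s)
    (a : K) (ha : a ≠ 0) :
    (Even s → ∀ c : K, ∀ ψ : Aa K 1 s a c →ₗ[K] K, IsPsi K 1 s a c ψ →
      ∃ I : Ideal (Subalgebra.center K (Aa K 1 s a c)),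
        (∀ z : Subalgebra.center K (Aa K 1 s a c),
          z ∈ I ↔ (z : Aa K 1 s a c) ∈ perp K 1 s a c ψ) ∧
        Nonempty ((Subalgebra.center K (Aa K 1 s a c) ⧸ I) ≃ₐ[K]
          (Polynomial K ⧸ (Ideal.span {(X : Polynomial K) ^ (s / 2)})))) ∧
    (Odd s → ∀ c : K, c ≠ 0 → ∀ ψ : Aa K 1 s a c →ₗ[K] K, IsPsi K 1 s a c ψ →
      ∃ I : Ideal (Subalgebra.center K (Aa K 1 s a c)),
        (∀ z : Subalgebra.center K (Aa K 1 s a c),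
          z ∈ I ↔ (z : Aa K 1 s a c) ∈ perp K 1 s a c ψ) ∧
        Nonempty ((Subalgebra.center K (Aa K 1 s a c) ⧸ I) ≃ₐ[K]
          (Polynomial K ⧸ (Ideal.span {(X : Polynomial K) ^ ((s + 1) / 2)})))) ∧
    (Odd s → ¬ IsSquare a → ∀ ψ : Aa K 1 s a 0 →ₗ[K] K, IsPsi K 1 s a 0 ψ →
      ∃ I : Ideal (Subalgebra.center K (Aa K 1 s a 0)),
        (∀ z : Subalgebra.center K (Aa K 1 s a 0),
          z ∈ I ↔ (z : Aa K 1 s a 0) ∈ perp K 1 s a 0 ψ) ∧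
        Nonempty ((Subalgebra.center K (Aa K 1 s a 0) ⧸ I) ≃ₐ[K]
          (Polynomial K ⧸ (Ideal.span {(X : Polynomial K) ^ ((s + 1) / 2)})))) ∧
    (5 ≤ s → Odd s → ∀ b : K, a = b ^ 2 → ∀ ψ : Aa K 1 s a 0 →ₗ[K] K, IsPsi K 1 s a 0 ψ →
      ∃ I : Ideal (Subalgebra.center K (Aa K 1 s a 0)),
        (∀ z : Subalgebra.center K (Aa K 1 s a 0),
          z ∈ I ↔ (z : Aa K 1 s a 0) ∈ perp K 1 s a 0 ψ) ∧
        Nonempty ((Subalgebra.center K (Aa K 1 s a 0) ⧸ I) ≃ₐ[K]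
          (Polynomial K ⧸ (Ideal.span {(X : Polynomial K) ^ ((s + 3) / 2)})))) := by
  refine ⟨?_, ?_, ?_, ?_⟩
  · rintro ⟨k, rfl⟩ c ψ hψ
    refine QRep.simple_case ha hs _ (k + 1) hψ (by omega) (by omega) (by omega) ?_
    intro p q m n h
    obtain ⟨h1, h2, h3, h4⟩ := QRep.T1_cond ha hs h
    have e := QRep.coeff_sq_odd q (k - 1)
    rw [show 2 * (k - 1) + 1 = k + k - 1 by omega] at e
    have hp : p.coeff 1 = 0 := by simpa [e, ha] using h3
    rw [← two_mul, QRep.coeff_sq_even, hp] at h4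
    refine ⟨X_pow_dvd_iff.2 fun i hi => ?_, X_pow_dvd_iff.2 fun i hi => ?_⟩
    · interval_cases i <;> assumption
    · rcases Nat.lt_succ_iff_lt_or_eq.1 hi with h' | rfl
      · exact h2 i (by omega)
      · simpa using h4
  · rintro ⟨k, rfl⟩ c hc ψ hψ
    refine QRep.simple_case ha hs _ (k + 1) hψ (by omega) (by omega) (by omega) ?_
    intro p q m n h
    obtain ⟨h1, h2, h3, h4⟩ := QRep.T1_cond ha hs h
    rw [QRep.coeff_sq_odd] at h4
    have hp : p.coeff 1 = 0 := by simpa [hc] using h4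
    rw [Nat.add_sub_cancel, QRep.coeff_sq_even, hp] at h3
    refine ⟨X_pow_dvd_iff.2 fun i hi => ?_, X_pow_dvd_iff.2 fun i hi => ?_⟩
    · interval_cases i <;> assumption
    · rcases Nat.lt_succ_iff_lt_or_eq.1 hi with h' | rfl
      · exact h2 i (by omega)
      · simpa using h3
  · rintro ⟨k, rfl⟩ hsq ψ hψ
    refine QRep.simple_case ha hs _ (k + 1) hψ (by omega) (by omega) (by omega) ?_
    intro p q m n h
    obtain ⟨h1, h2, h3, h4⟩ := QRep.T1_cond ha hs h
    rw [Nat.add_sub_cancel, QRep.coeff_sq_even] at h3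
    have hp : p.coeff 1 = 0 := by
      by_contra hp
      refine hsq ⟨q.coeff k / p.coeff 1, ?_⟩
      have two : (2 : K) = 0 := CharTwo.two_eq_zero
      field_simp
      linear_combination h3 - q.coeff k ^ 2 * two
    rw [hp] at h3
    refine ⟨X_pow_dvd_iff.2 fun i hi => ?_, X_pow_dvd_iff.2 fun i hi => ?_⟩
    · interval_cases i <;> assumption
    · rcases Nat.lt_succ_iff_lt_or_eq.1 hi with h' | rfl
      · exact h2 i (by omega)
      · simpa using h3
  · rintro h5 ⟨k, rfl⟩ b hb ψ hψ
    have := QRep.last_case ha k (by omega) b hb hψ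
    rwa [show (2 * k + 1 + 3) / 2 = k + 2 by omega]
end

section
/- Let K have characteristic 2. If d = e² for some e ∈ K, then T₁(B(d)) = [B(d),B(d)] + K·s₁ + K·(γβ + e·ηδ), and dim_K T₁(B(d))/[B(d),B(d)] = 2. If d is not a square in K, then T₁(B(d)) = [B(d),B(d)] + K·s₁, and dim_K T₁(B(d))/[B(d),B(d)] = 1. -/
namespace QT3

/-- Generators: the three vertex idempotents `f1, f2, f3` and the arrows
`bb` (β : 1 → 2), `gg` (γ : 2 → 1), `dd` (δ : 2 → 3), `hh` (η : 3 → 2). -/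
inductive Gen3 : Type
  | f1 : Gen3
  | f2 : Gen3
  | f3 : Gen3
  | bb : Gen3
  | gg : Gen3
  | dd : Gen3
  | hh : Gen3

open Gen3

/-- Generators as elements of the free algebra. -/
noncomputable def gen (K : Type) [Field K] (g : Gen3) : FreeAlgebra K Gen3 :=
  FreeAlgebra.ι K g

/-- The defining relations of the algebra B(d) = Q(3𝒜)₁^{2,2}(d): the path-algebra
relations of the quiver 1 ⇄ 2 ⇄ 3 (paths composed left to right), together with
βδη = βγβ, δηγ = γβγ, ηγβ = d·ηδη, γβδ = d·δηδ, βδηδ = 0, ηγβγ = 0. -/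
inductive Rel3 (K : Type) [Field K] (d : K) :
    FreeAlgebra K Gen3 → FreeAlgebra K Gen3 → Prop
  | idem1 : Rel3 K d (gen K f1 * gen K f1) (gen K f1)
  | idem2 : Rel3 K d (gen K f2 * gen K f2) (gen K f2)
  | idem3 : Rel3 K d (gen K f3 * gen K f3) (gen K f3)
  | orth12 : Rel3 K d (gen K f1 * gen K f2) 0
  | orth21 : Rel3 K d (gen K f2 * gen K f1) 0
  | orth13 : Rel3 K d (gen K f1 * gen K f3) 0
  | orth31 : Rel3 K d (gen K f3 * gen K f1) 0
  | orth23 : Rel3 K d (gen K f2 * gen K f3) 0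
  | orth32 : Rel3 K d (gen K f3 * gen K f2) 0
  | sum_idem : Rel3 K d (gen K f1 + gen K f2 + gen K f3) 1
  | bb_left : Rel3 K d (gen K f1 * gen K bb) (gen K bb)
  | bb_right : Rel3 K d (gen K bb * gen K f2) (gen K bb)
  | gg_left : Rel3 K d (gen K f2 * gen K gg) (gen K gg)
  | gg_right : Rel3 K d (gen K gg * gen K f1) (gen K gg)
  | dd_left : Rel3 K d (gen K f2 * gen K dd) (gen K dd)
  | dd_right : Rel3 K d (gen K dd * gen K f3) (gen K dd)
  | hh_left : Rel3 K d (gen K f3 * gen K hh) (gen K hh)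
  | hh_right : Rel3 K d (gen K hh * gen K f2) (gen K hh)
  | rel1 : Rel3 K d (gen K bb * gen K dd * gen K hh) (gen K bb * gen K gg * gen K bb)
  | rel2 : Rel3 K d (gen K dd * gen K hh * gen K gg) (gen K gg * gen K bb * gen K gg)
  | rel3 : Rel3 K d (gen K hh * gen K gg * gen K bb)
      (d • (gen K hh * gen K dd * gen K hh))
  | rel4 : Rel3 K d (gen K gg * gen K bb * gen K dd)
      (d • (gen K dd * gen K hh * gen K dd))
  | rel5 : Rel3 K d (gen K bb * gen K dd * gen K hh * gen K dd) 0
  | rel6 : Rel3 K d (gen K hh * gen K gg * gen K bb * gen K gg) 0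

/-- The algebra B(d) = Q(3𝒜)₁^{2,2}(d) of quaternion type with three simple modules. -/
abbrev Bd (K : Type) [Field K] (d : K) : Type := RingQuot (Rel3 K d)

variable (K : Type) [Field K] (d : K)

/-- The idempotent e₁ in B(d). -/
noncomputable def F1 : Bd K d := RingQuot.mkAlgHom K (Rel3 K d) (gen K f1)
/-- The idempotent e₂ in B(d). -/
noncomputable def F2 : Bd K d := RingQuot.mkAlgHom K (Rel3 K d) (gen K f2)
/-- The idempotent e₃ in B(d). -/
noncomputable def F3 : Bd K d := RingQuot.mkAlgHom K (Rel3 K d) (gen K f3)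
/-- The arrow β in B(d). -/
noncomputable def Bb : Bd K d := RingQuot.mkAlgHom K (Rel3 K d) (gen K bb)
/-- The arrow γ in B(d). -/
noncomputable def Gg : Bd K d := RingQuot.mkAlgHom K (Rel3 K d) (gen K gg)
/-- The arrow δ in B(d). -/
noncomputable def Dd : Bd K d := RingQuot.mkAlgHom K (Rel3 K d) (gen K dd)
/-- The arrow η in B(d). -/
noncomputable def Hh : Bd K d := RingQuot.mkAlgHom K (Rel3 K d) (gen K hh)

/-- The socle element s₁ = βδηγ. -/
noncomputable def S1 : Bd K d := Bb K d * Dd K d * Hh K d * Gg K d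
/-- The socle element s₂ = ηγβδ. -/
noncomputable def S2 : Bd K d := Hh K d * Gg K d * Bb K d * Dd K d
/-- The socle element s₃ = γβδη. -/
noncomputable def S3 : Bd K d := Gg K d * Bb K d * Dd K d * Hh K d

/-- The commutator subspace [B(d),B(d)]. -/
noncomputable def comm3 : Submodule K (Bd K d) :=
  Submodule.span K {z : Bd K d | ∃ u v : Bd K d, z = u * v - v * u}

/-- The four arrows of the quiver, as a family indexed by `Fin 4`. -/
noncomputable def arr : Fin 4 → Bd K d := ![Bb K d, Gg K d, Dd K d, Hh K d]

/-- `ψ` is the linear form on B(d) with ψ(s₁) = ψ(s₂) = ψ(s₃) = 1 and ψ vanishing on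
the images of all paths of length at most 3 (the length-0 paths being e₁, e₂, e₃ and
the positive-length paths being the products of at most three arrows). -/
noncomputable def IsPsiB (ψ : Bd K d →ₗ[K] K) : Prop :=
  ψ (S1 K d) = 1 ∧ ψ (S2 K d) = 1 ∧ ψ (S3 K d) = 1 ∧
  ψ (F1 K d) = 0 ∧ ψ (F2 K d) = 0 ∧ ψ (F3 K d) = 0 ∧
  ∀ l : List (Fin 4), l ≠ [] → l.length ≤ 3 → ψ ((l.map (arr K d)).prod) = 0

/-- The set T₁(B(d)) = {x : x² ∈ [B(d),B(d)]} (characteristic 2). -/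
noncomputable def T1B : Set (Bd K d) :=
  {z : Bd K d | z ^ 2 ∈ comm3 K d}

/-- The orthogonal space T₁(B(d))^⊥ with respect to the form ⟨u,v⟩ = ψ(uv). -/
noncomputable def perpB (ψ : Bd K d →ₗ[K] K) : Submodule K (Bd K d) :=
  ⨅ m ∈ T1B K d, LinearMap.ker (ψ ∘ₗ LinearMap.mulRight K m)

end QT3


set_option linter.unusedSimpArgs false
set_option linter.unusedVariables false

namespace QT3

/-- The nine-dimensional commutative algebra
`K[b,l]/(b l^2 - b^3, l b^2 - d l^3, b l^3, l b^3)`, in coordinates. -/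
@[ext] structure RR (K : Type) [Field K] (d : K) : Type where
  c : K
  b : K
  l : K
  b2 : K
  m : K
  l2 : K
  b3 : K
  l3 : K
  s : K

namespace RR
variable {K : Type} [Field K] {d : K}

instance : Zero (RR K d) := ⟨⟨0,0,0,0,0,0,0,0,0⟩⟩
instance : One (RR K d) := ⟨⟨1,0,0,0,0,0,0,0,0⟩⟩
instance : Add (RR K d) := ⟨fun x y => ⟨x.c+y.c,x.b+y.b,x.l+y.l,x.b2+y.b2,x.m+y.m,x.l2+y.l2,x.b3+y.b3,x.l3+y.l3,x.s+y.s⟩⟩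
instance : Neg (RR K d) := ⟨fun x => ⟨-x.c,-x.b,-x.l,-x.b2,-x.m,-x.l2,-x.b3,-x.l3,-x.s⟩⟩
instance : Mul (RR K d) := ⟨fun x y => ⟨x.c*y.c,
  x.c*y.b+x.b*y.c,
  x.c*y.l+x.l*y.c,
  x.c*y.b2+x.b*y.b+x.b2*y.c,
  x.c*y.m+x.b*y.l+x.l*y.b+x.m*y.c,
  x.c*y.l2+x.l*y.l+x.l2*y.c,
  x.c*y.b3+x.b*y.b2+x.b2*y.b+x.b*y.l2+x.l2*y.b+x.l*y.m+x.m*y.l+x.b3*y.c,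
  x.c*y.l3+x.l*y.l2+x.l2*y.l+d*(x.l*y.b2+x.b2*y.l+x.b*y.m+x.m*y.b)+x.l3*y.c,
  x.c*y.s+d*(x.b*y.b3+x.b3*y.b+x.b2*y.b2+x.b2*y.l2+x.l2*y.b2+x.m*y.m)+x.l*y.l3+x.l3*y.l+x.l2*y.l2+x.s*y.c⟩⟩

@[simp] lemma zero_c : (0 : RR K d).c = 0 := rfl
@[simp] lemma one_c : (1 : RR K d).c = 1 := rfl
@[simp] lemma add_c (x y : RR K d) : (x + y).c = x.c + y.c := rfl
@[simp] lemma neg_c (x : RR K d) : (-x).c = -x.c := rfl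
@[simp] lemma mul_c (x y : RR K d) : (x * y).c =
    x.c*y.c := rfl
@[simp] lemma zero_b : (0 : RR K d).b = 0 := rfl
@[simp] lemma one_b : (1 : RR K d).b = 0 := rfl
@[simp] lemma add_b (x y : RR K d) : (x + y).b = x.b + y.b := rfl
@[simp] lemma neg_b (x : RR K d) : (-x).b = -x.b := rfl
@[simp] lemma mul_b (x y : RR K d) : (x * y).b =
    x.c*y.b+x.b*y.c := rfl
@[simp] lemma zero_l : (0 : RR K d).l = 0 := rfl
@[simp] lemma one_l : (1 : RR K d).l = 0 := rfl
@[simp] lemma add_l (x y : RR K d) : (x + y).l = x.l + y.l := rfl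
@[simp] lemma neg_l (x : RR K d) : (-x).l = -x.l := rfl
@[simp] lemma mul_l (x y : RR K d) : (x * y).l =
    x.c*y.l+x.l*y.c := rfl
@[simp] lemma zero_b2 : (0 : RR K d).b2 = 0 := rfl
@[simp] lemma one_b2 : (1 : RR K d).b2 = 0 := rfl
@[simp] lemma add_b2 (x y : RR K d) : (x + y).b2 = x.b2 + y.b2 := rfl
@[simp] lemma neg_b2 (x : RR K d) : (-x).b2 = -x.b2 := rfl
@[simp] lemma mul_b2 (x y : RR K d) : (x * y).b2 =
    x.c*y.b2+x.b*y.b+x.b2*y.c := rfl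
@[simp] lemma zero_m : (0 : RR K d).m = 0 := rfl
@[simp] lemma one_m : (1 : RR K d).m = 0 := rfl
@[simp] lemma add_m (x y : RR K d) : (x + y).m = x.m + y.m := rfl
@[simp] lemma neg_m (x : RR K d) : (-x).m = -x.m := rfl
@[simp] lemma mul_m (x y : RR K d) : (x * y).m =
    x.c*y.m+x.b*y.l+x.l*y.b+x.m*y.c := rfl
@[simp] lemma zero_l2 : (0 : RR K d).l2 = 0 := rfl
@[simp] lemma one_l2 : (1 : RR K d).l2 = 0 := rfl
@[simp] lemma add_l2 (x y : RR K d) : (x + y).l2 = x.l2 + y.l2 := rfl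
@[simp] lemma neg_l2 (x : RR K d) : (-x).l2 = -x.l2 := rfl
@[simp] lemma mul_l2 (x y : RR K d) : (x * y).l2 =
    x.c*y.l2+x.l*y.l+x.l2*y.c := rfl
@[simp] lemma zero_b3 : (0 : RR K d).b3 = 0 := rfl
@[simp] lemma one_b3 : (1 : RR K d).b3 = 0 := rfl
@[simp] lemma add_b3 (x y : RR K d) : (x + y).b3 = x.b3 + y.b3 := rfl
@[simp] lemma neg_b3 (x : RR K d) : (-x).b3 = -x.b3 := rfl
@[simp] lemma mul_b3 (x y : RR K d) : (x * y).b3 =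
    x.c*y.b3+x.b*y.b2+x.b2*y.b+x.b*y.l2+x.l2*y.b+x.l*y.m+x.m*y.l+x.b3*y.c := rfl
@[simp] lemma zero_l3 : (0 : RR K d).l3 = 0 := rfl
@[simp] lemma one_l3 : (1 : RR K d).l3 = 0 := rfl
@[simp] lemma add_l3 (x y : RR K d) : (x + y).l3 = x.l3 + y.l3 := rfl
@[simp] lemma neg_l3 (x : RR K d) : (-x).l3 = -x.l3 := rfl
@[simp] lemma mul_l3 (x y : RR K d) : (x * y).l3 =
    x.c*y.l3+x.l*y.l2+x.l2*y.l+d*(x.l*y.b2+x.b2*y.l+x.b*y.m+x.m*y.b)+x.l3*y.c := rfl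
@[simp] lemma zero_s : (0 : RR K d).s = 0 := rfl
@[simp] lemma one_s : (1 : RR K d).s = 0 := rfl
@[simp] lemma add_s (x y : RR K d) : (x + y).s = x.s + y.s := rfl
@[simp] lemma neg_s (x : RR K d) : (-x).s = -x.s := rfl
@[simp] lemma mul_s (x y : RR K d) : (x * y).s =
    x.c*y.s+d*(x.b*y.b3+x.b3*y.b+x.b2*y.b2+x.b2*y.l2+x.l2*y.b2+x.m*y.m)+x.l*y.l3+x.l3*y.l+x.l2*y.l2+x.s*y.c := rfl

instance : CommRing (RR K d) where
  add_assoc x y z := by ext <;> simp <;> ring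
  zero_add x := by ext <;> simp
  add_zero x := by ext <;> simp
  add_comm x y := by ext <;> simp <;> ring
  left_distrib x y z := by ext <;> simp <;> ring
  right_distrib x y z := by ext <;> simp <;> ring
  zero_mul x := by ext <;> simp
  mul_zero x := by ext <;> simp
  mul_assoc x y z := by ext <;> simp <;> ring
  one_mul x := by ext <;> simp
  mul_one x := by ext <;> simp
  neg_add_cancel x := by ext <;> simp
  mul_comm x y := by ext <;> simp <;> ring
  nsmul := nsmulRec
  zsmul := zsmulRec

/-- Scalars. -/
def C : K →+* RR K d where
  toFun a := ⟨a,0,0,0,0,0,0,0,0⟩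
  map_one' := rfl
  map_zero' := rfl
  map_add' x y := by ext <;> simp
  map_mul' x y := by ext <;> simp

instance : Algebra K (RR K d) := C.toAlgebra

@[simp] lemma smul_c (a : K) (x : RR K d) : (a • x).c = a * x.c := by
  rw [Algebra.smul_def]; change (C a * x).c = _; simp [C]
@[simp] lemma smul_b (a : K) (x : RR K d) : (a • x).b = a * x.b := by
  rw [Algebra.smul_def]; change (C a * x).b = _; simp [C]
@[simp] lemma smul_l (a : K) (x : RR K d) : (a • x).l = a * x.l := by
  rw [Algebra.smul_def]; change (C a * x).l = _; simp [C]
@[simp] lemma smul_b2 (a : K) (x : RR K d) : (a • x).b2 = a * x.b2 := by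
  rw [Algebra.smul_def]; change (C a * x).b2 = _; simp [C]
@[simp] lemma smul_m (a : K) (x : RR K d) : (a • x).m = a * x.m := by
  rw [Algebra.smul_def]; change (C a * x).m = _; simp [C]
@[simp] lemma smul_l2 (a : K) (x : RR K d) : (a • x).l2 = a * x.l2 := by
  rw [Algebra.smul_def]; change (C a * x).l2 = _; simp [C]
@[simp] lemma smul_b3 (a : K) (x : RR K d) : (a • x).b3 = a * x.b3 := by
  rw [Algebra.smul_def]; change (C a * x).b3 = _; simp [C]
@[simp] lemma smul_l3 (a : K) (x : RR K d) : (a • x).l3 = a * x.l3 := by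
  rw [Algebra.smul_def]; change (C a * x).l3 = _; simp [C]
@[simp] lemma smul_s (a : K) (x : RR K d) : (a • x).s = a * x.s := by
  rw [Algebra.smul_def]; change (C a * x).s = _; simp [C]

/-- The generator `b`. -/
def B : RR K d := ⟨0,1,0,0,0,0,0,0,0⟩
/-- The generator `l`. -/
def L : RR K d := ⟨0,0,1,0,0,0,0,0,0⟩

/-- Coordinate of `b^2`. -/
def cb2 : RR K d →ₗ[K] K where
  toFun x := x.b2
  map_add' _ _ := rfl
  map_smul' a x := by simp
/-- Coordinate of `l^2`. -/
def cl2 : RR K d →ₗ[K] K where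
  toFun x := x.l2
  map_add' _ _ := rfl
  map_smul' a x := by simp
/-- Coordinate of `l^4`. -/
def cs : RR K d →ₗ[K] K where
  toFun x := x.s
  map_add' _ _ := rfl
  map_smul' a x := by simp

end RR

open Matrix in
/-- The matrix images of the generators. -/
def matGen (K : Type) [Field K] (d : K) : Gen3 → Matrix (Fin 3) (Fin 3) (RR K d)
  | .f1 => single 0 0 1
  | .f2 => single 1 1 1
  | .f3 => single 2 2 1
  | .bb => single 0 1 RR.B
  | .gg => single 1 0 RR.B
  | .dd => single 1 2 RR.L
  | .hh => single 2 1 RR.L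

/-- The representation over `RR`. -/
noncomputable def Phi (K : Type) [Field K] (d : K) :
    Bd K d →ₐ[K] Matrix (Fin 3) (Fin 3) (RR K d) :=
  RingQuot.liftAlgHom K ⟨FreeAlgebra.lift K (matGen K d), by
    intro x y h
    cases h
    case sum_idem =>
      simp only [gen, map_add, map_one, FreeAlgebra.lift_ι_apply, matGen]
      ext i j : 1
      fin_cases i <;> fin_cases j <;> simp [Matrix.single]
    all_goals
      simp only [gen, map_mul, map_smul, map_zero, FreeAlgebra.lift_ι_apply, matGen,
        Matrix.single_mul_single_same, Matrix.smul_single, mul_one, one_mul]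
    case rel1 => congr 1; ext <;> simp [RR.B, RR.L]
    case rel2 => congr 1; ext <;> simp [RR.B, RR.L]
    case rel3 => congr 1; ext <;> simp [RR.B, RR.L]
    case rel4 => congr 1; ext <;> simp [RR.B, RR.L]
    case rel5 =>
      rw [← Matrix.single_zero 0 2]; congr 1; ext <;> simp [RR.B, RR.L]
    case rel6 =>
      rw [← Matrix.single_zero 2 0]; congr 1; ext <;> simp [RR.B, RR.L]
    all_goals exact Matrix.single_mul_single_of_ne _ _ _ _ (by decide) _⟩

/-- Values of the three characters. -/
def chGen (K : Type) [Field K] : Gen3 → K × K × K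
  | .f1 => (1, 0, 0)
  | .f2 => (0, 1, 0)
  | .f3 => (0, 0, 1)
  | _ => 0

/-- The three characters. -/
noncomputable def Chi (K : Type) [Field K] (d : K) : Bd K d →ₐ[K] K × K × K :=
  RingQuot.liftAlgHom K ⟨FreeAlgebra.lift K (chGen K), by
    intro x y h
    cases h <;> simp [gen, chGen]⟩

section vals
variable (K : Type) [Field K] (d : K)
lemma Phi_F1 : Phi K d (F1 K d) = matGen K d .f1 := by
  simp [Phi, F1, gen]
lemma Chi_F1 : Chi K d (F1 K d) = chGen K .f1 := by
  simp [Chi, F1, gen]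
lemma Phi_F2 : Phi K d (F2 K d) = matGen K d .f2 := by
  simp [Phi, F2, gen]
lemma Chi_F2 : Chi K d (F2 K d) = chGen K .f2 := by
  simp [Chi, F2, gen]
lemma Phi_F3 : Phi K d (F3 K d) = matGen K d .f3 := by
  simp [Phi, F3, gen]
lemma Chi_F3 : Chi K d (F3 K d) = chGen K .f3 := by
  simp [Chi, F3, gen]
lemma Phi_Bb : Phi K d (Bb K d) = matGen K d .bb := by
  simp [Phi, Bb, gen]
lemma Chi_Bb : Chi K d (Bb K d) = chGen K .bb := by
  simp [Chi, Bb, gen]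
lemma Phi_Gg : Phi K d (Gg K d) = matGen K d .gg := by
  simp [Phi, Gg, gen]
lemma Chi_Gg : Chi K d (Gg K d) = chGen K .gg := by
  simp [Chi, Gg, gen]
lemma Phi_Dd : Phi K d (Dd K d) = matGen K d .dd := by
  simp [Phi, Dd, gen]
lemma Chi_Dd : Chi K d (Dd K d) = chGen K .dd := by
  simp [Chi, Dd, gen]
lemma Phi_Hh : Phi K d (Hh K d) = matGen K d .hh := by
  simp [Phi, Hh, gen]
lemma Chi_Hh : Chi K d (Hh K d) = chGen K .hh := by
  simp [Chi, Hh, gen]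
lemma r_idem1 : F1 K d * F1 K d = (F1 K d) := by
  have h := RingQuot.mkAlgHom_rel K (Rel3.idem1 (K := K) (d := d))
  simp only [map_mul, map_add, map_smul, map_zero, map_one] at h
  exact h
lemma r_idem2 : F2 K d * F2 K d = (F2 K d) := by
  have h := RingQuot.mkAlgHom_rel K (Rel3.idem2 (K := K) (d := d))
  simp only [map_mul, map_add, map_smul, map_zero, map_one] at h
  exact h
lemma r_idem3 : F3 K d * F3 K d = (F3 K d) := by
  have h := RingQuot.mkAlgHom_rel K (Rel3.idem3 (K := K) (d := d))
  simp only [map_mul, map_add, map_smul, map_zero, map_one] at h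
  exact h
lemma r_orth12 : F1 K d * F2 K d = 0 := by
  have h := RingQuot.mkAlgHom_rel K (Rel3.orth12 (K := K) (d := d))
  simp only [map_mul, map_add, map_smul, map_zero, map_one] at h
  exact h
lemma r_orth21 : F2 K d * F1 K d = 0 := by
  have h := RingQuot.mkAlgHom_rel K (Rel3.orth21 (K := K) (d := d))
  simp only [map_mul, map_add, map_smul, map_zero, map_one] at h
  exact h
lemma r_orth13 : F1 K d * F3 K d = 0 := by
  have h := RingQuot.mkAlgHom_rel K (Rel3.orth13 (K := K) (d := d))
  simp only [map_mul, map_add, map_smul, map_zero, map_one] at h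
  exact h
lemma r_orth31 : F3 K d * F1 K d = 0 := by
  have h := RingQuot.mkAlgHom_rel K (Rel3.orth31 (K := K) (d := d))
  simp only [map_mul, map_add, map_smul, map_zero, map_one] at h
  exact h
lemma r_orth23 : F2 K d * F3 K d = 0 := by
  have h := RingQuot.mkAlgHom_rel K (Rel3.orth23 (K := K) (d := d))
  simp only [map_mul, map_add, map_smul, map_zero, map_one] at h
  exact h
lemma r_orth32 : F3 K d * F2 K d = 0 := by
  have h := RingQuot.mkAlgHom_rel K (Rel3.orth32 (K := K) (d := d))
  simp only [map_mul, map_add, map_smul, map_zero, map_one] at h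
  exact h
lemma r_sum_idem : F1 K d + F2 K d + F3 K d = 1 := by
  have h := RingQuot.mkAlgHom_rel K (Rel3.sum_idem (K := K) (d := d))
  simp only [map_mul, map_add, map_smul, map_zero, map_one] at h
  exact h
lemma r_bb_left : F1 K d * Bb K d = (Bb K d) := by
  have h := RingQuot.mkAlgHom_rel K (Rel3.bb_left (K := K) (d := d))
  simp only [map_mul, map_add, map_smul, map_zero, map_one] at h
  exact h
lemma r_bb_right : Bb K d * F2 K d = (Bb K d) := by
  have h := RingQuot.mkAlgHom_rel K (Rel3.bb_right (K := K) (d := d))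
  simp only [map_mul, map_add, map_smul, map_zero, map_one] at h
  exact h
lemma r_gg_left : F2 K d * Gg K d = (Gg K d) := by
  have h := RingQuot.mkAlgHom_rel K (Rel3.gg_left (K := K) (d := d))
  simp only [map_mul, map_add, map_smul, map_zero, map_one] at h
  exact h
lemma r_gg_right : Gg K d * F1 K d = (Gg K d) := by
  have h := RingQuot.mkAlgHom_rel K (Rel3.gg_right (K := K) (d := d))
  simp only [map_mul, map_add, map_smul, map_zero, map_one] at h
  exact h
lemma r_dd_left : F2 K d * Dd K d = (Dd K d) := by
  have h := RingQuot.mkAlgHom_rel K (Rel3.dd_left (K := K) (d := d))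
  simp only [map_mul, map_add, map_smul, map_zero, map_one] at h
  exact h
lemma r_dd_right : Dd K d * F3 K d = (Dd K d) := by
  have h := RingQuot.mkAlgHom_rel K (Rel3.dd_right (K := K) (d := d))
  simp only [map_mul, map_add, map_smul, map_zero, map_one] at h
  exact h
lemma r_hh_left : F3 K d * Hh K d = (Hh K d) := by
  have h := RingQuot.mkAlgHom_rel K (Rel3.hh_left (K := K) (d := d))
  simp only [map_mul, map_add, map_smul, map_zero, map_one] at h
  exact h
lemma r_hh_right : Hh K d * F2 K d = (Hh K d) := by
  have h := RingQuot.mkAlgHom_rel K (Rel3.hh_right (K := K) (d := d))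
  simp only [map_mul, map_add, map_smul, map_zero, map_one] at h
  exact h
lemma r_rel1 : Bb K d * Dd K d * Hh K d = (Bb K d * Gg K d * Bb K d) := by
  have h := RingQuot.mkAlgHom_rel K (Rel3.rel1 (K := K) (d := d))
  simp only [map_mul, map_add, map_smul, map_zero, map_one] at h
  exact h
lemma r_rel2 : Dd K d * Hh K d * Gg K d = (Gg K d * Bb K d * Gg K d) := by
  have h := RingQuot.mkAlgHom_rel K (Rel3.rel2 (K := K) (d := d))
  simp only [map_mul, map_add, map_smul, map_zero, map_one] at h
  exact h
lemma r_rel3 : Hh K d * Gg K d * Bb K d = (d • (Hh K d * Dd K d * Hh K d)) := by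
  have h := RingQuot.mkAlgHom_rel K (Rel3.rel3 (K := K) (d := d))
  simp only [map_mul, map_add, map_smul, map_zero, map_one] at h
  exact h
lemma r_rel4 : Gg K d * Bb K d * Dd K d = (d • (Dd K d * Hh K d * Dd K d)) := by
  have h := RingQuot.mkAlgHom_rel K (Rel3.rel4 (K := K) (d := d))
  simp only [map_mul, map_add, map_smul, map_zero, map_one] at h
  exact h
lemma r_rel5 : Bb K d * Dd K d * Hh K d * Dd K d = 0 := by
  have h := RingQuot.mkAlgHom_rel K (Rel3.rel5 (K := K) (d := d))
  simp only [map_mul, map_add, map_smul, map_zero, map_one] at h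
  exact h
lemma r_rel6 : Hh K d * Gg K d * Bb K d * Gg K d = 0 := by
  have h := RingQuot.mkAlgHom_rel K (Rel3.rel6 (K := K) (d := d))
  simp only [map_mul, map_add, map_smul, map_zero, map_one] at h
  exact h
end vals

/-- Seven elements of an algebra satisfying the relations of `B(d)`. -/
structure Rep {K A : Type} [Field K] [Ring A] [Algebra K A] (d : K)
    (e1 e2 e3 β γ δ η : A) : Prop where
  h11 : e1 * e1 = e1
  h12 : e1 * e2 = 0
  h13 : e1 * e3 = 0
  h21 : e2 * e1 = 0
  h22 : e2 * e2 = e2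
  h23 : e2 * e3 = 0
  h31 : e3 * e1 = 0
  h32 : e3 * e2 = 0
  h33 : e3 * e3 = e3
  βl : e1 * β = β
  βr : β * e2 = β
  γl : e2 * γ = γ
  γr : γ * e1 = γ
  δl : e2 * δ = δ
  δr : δ * e3 = δ
  ηl : e3 * η = η
  ηr : η * e2 = η
  hs : e1 + e2 + e3 = 1
  r1 : β * δ * η = β * γ * β
  r2 : δ * η * γ = γ * β * γ
  r3 : η * γ * β = d • (η * δ * η)
  r4 : γ * β * δ = d • (δ * η * δ)
  r5 : β * δ * η * δ = 0
  r6 : η * γ * β * γ = 0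

namespace Rep
variable {K A : Type} [Field K] [Ring A] [Algebra K A] {d : K}
  {e1 e2 e3 β γ δ η : A}

lemma z_βe1 (R : Rep d e1 e2 e3 β γ δ η) : β * e1 = 0 := by
  rw [← R.βr, mul_assoc, R.h21, mul_zero]
lemma z_e2β (R : Rep d e1 e2 e3 β γ δ η) : e2 * β = 0 := by
  rw [← R.βl, ← mul_assoc, R.h21, zero_mul]
lemma z_e3β (R : Rep d e1 e2 e3 β γ δ η) : e3 * β = 0 := by
  rw [← R.βl, ← mul_assoc, R.h31, zero_mul]
lemma z_βe3 (R : Rep d e1 e2 e3 β γ δ η) : β * e3 = 0 := by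
  rw [← R.βr, mul_assoc, R.h23, mul_zero]
lemma z_e1γ (R : Rep d e1 e2 e3 β γ δ η) : e1 * γ = 0 := by
  rw [← R.γl, ← mul_assoc, R.h12, zero_mul]
lemma z_γe2 (R : Rep d e1 e2 e3 β γ δ η) : γ * e2 = 0 := by
  rw [← R.γr, mul_assoc, R.h12, mul_zero]
lemma z_e3γ (R : Rep d e1 e2 e3 β γ δ η) : e3 * γ = 0 := by
  rw [← R.γl, ← mul_assoc, R.h32, zero_mul]
lemma z_γe3 (R : Rep d e1 e2 e3 β γ δ η) : γ * e3 = 0 := by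
  rw [← R.γr, mul_assoc, R.h13, mul_zero]
lemma z_e1δ (R : Rep d e1 e2 e3 β γ δ η) : e1 * δ = 0 := by
  rw [← R.δl, ← mul_assoc, R.h12, zero_mul]
lemma z_δe1 (R : Rep d e1 e2 e3 β γ δ η) : δ * e1 = 0 := by
  rw [← R.δr, mul_assoc, R.h31, mul_zero]
lemma z_δe2 (R : Rep d e1 e2 e3 β γ δ η) : δ * e2 = 0 := by
  rw [← R.δr, mul_assoc, R.h32, mul_zero]
lemma z_e3δ (R : Rep d e1 e2 e3 β γ δ η) : e3 * δ = 0 := by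
  rw [← R.δl, ← mul_assoc, R.h32, zero_mul]
lemma z_e1η (R : Rep d e1 e2 e3 β γ δ η) : e1 * η = 0 := by
  rw [← R.ηl, ← mul_assoc, R.h13, zero_mul]
lemma z_ηe1 (R : Rep d e1 e2 e3 β γ δ η) : η * e1 = 0 := by
  rw [← R.ηr, mul_assoc, R.h21, mul_zero]
lemma z_e2η (R : Rep d e1 e2 e3 β γ δ η) : e2 * η = 0 := by
  rw [← R.ηl, ← mul_assoc, R.h23, zero_mul]
lemma z_ηe3 (R : Rep d e1 e2 e3 β γ δ η) : η * e3 = 0 := by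
  rw [← R.ηr, mul_assoc, R.h23, mul_zero]
lemma z_ββ (R : Rep d e1 e2 e3 β γ δ η) : β * β = 0 := by
  have h : β * β = β * e2 * β := by rw [R.βr]
  rw [h, mul_assoc, R.z_e2β, mul_zero]
lemma z_βη (R : Rep d e1 e2 e3 β γ δ η) : β * η = 0 := by
  have h : β * η = β * e2 * η := by rw [R.βr]
  rw [h, mul_assoc, R.z_e2η, mul_zero]
lemma z_γγ (R : Rep d e1 e2 e3 β γ δ η) : γ * γ = 0 := by
  have h : γ * γ = γ * e1 * γ := by rw [R.γr]
  rw [h, mul_assoc, R.z_e1γ, mul_zero]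
lemma z_γδ (R : Rep d e1 e2 e3 β γ δ η) : γ * δ = 0 := by
  have h : γ * δ = γ * e1 * δ := by rw [R.γr]
  rw [h, mul_assoc, R.z_e1δ, mul_zero]
lemma z_γη (R : Rep d e1 e2 e3 β γ δ η) : γ * η = 0 := by
  have h : γ * η = γ * e1 * η := by rw [R.γr]
  rw [h, mul_assoc, R.z_e1η, mul_zero]
lemma z_δβ (R : Rep d e1 e2 e3 β γ δ η) : δ * β = 0 := by
  have h : δ * β = δ * e3 * β := by rw [R.δr]
  rw [h, mul_assoc, R.z_e3β, mul_zero]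
lemma z_δγ (R : Rep d e1 e2 e3 β γ δ η) : δ * γ = 0 := by
  have h : δ * γ = δ * e3 * γ := by rw [R.δr]
  rw [h, mul_assoc, R.z_e3γ, mul_zero]
lemma z_δδ (R : Rep d e1 e2 e3 β γ δ η) : δ * δ = 0 := by
  have h : δ * δ = δ * e3 * δ := by rw [R.δr]
  rw [h, mul_assoc, R.z_e3δ, mul_zero]
lemma z_ηβ (R : Rep d e1 e2 e3 β γ δ η) : η * β = 0 := by
  have h : η * β = η * e2 * β := by rw [R.ηr]
  rw [h, mul_assoc, R.z_e2β, mul_zero]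
lemma z_ηη (R : Rep d e1 e2 e3 β γ δ η) : η * η = 0 := by
  have h : η * η = η * e2 * η := by rw [R.ηr]
  rw [h, mul_assoc, R.z_e2η, mul_zero]
lemma βγβδ (R : Rep d e1 e2 e3 β γ δ η) : β * γ * β * δ = 0 := by
  rw [← R.r1, R.r5]
lemma γβγβ (R : Rep d e1 e2 e3 β γ δ η) : γ * β * γ * β = d • (δ * η * δ * η) := by
  rw [← R.r2, mul_assoc, mul_assoc, ← mul_assoc η, R.r3, mul_smul_comm]; simp only [mul_assoc]
lemma ηδηγ (R : Rep d e1 e2 e3 β γ δ η) : η * δ * η * γ = 0 := by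
  rw [mul_assoc, mul_assoc, ← mul_assoc δ, R.r2, ← mul_assoc, ← mul_assoc, R.r6]
lemma βγβγβ (R : Rep d e1 e2 e3 β γ δ η) : β * γ * β * γ * β = 0 := by
  rw [← R.r1, mul_assoc, mul_assoc, ← mul_assoc η, R.r3, mul_smul_comm, ← mul_assoc, ← mul_assoc, R.r5, zero_mul, smul_zero]
lemma δηδηγ (R : Rep d e1 e2 e3 β γ δ η) : δ * η * δ * η * γ = 0 := by
  rw [mul_assoc, mul_assoc, mul_assoc, ← mul_assoc η, ← mul_assoc (η * δ), R.ηδηγ, mul_zero]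
lemma δηδηδ (hd : d ≠ 0) (R : Rep d e1 e2 e3 β γ δ η) : δ * η * δ * η * δ = 0 := by
  have h : d • (δ * η * δ * η * δ) = 0 := by
    have h2 : γ * β * γ * β * δ = γ * (β * γ * β * δ) := by simp only [mul_assoc]
    rw [← smul_mul_assoc, ← R.γβγβ, h2, R.βγβδ, mul_zero]
  exact (smul_eq_zero.1 h).resolve_left hd
lemma ηδηδη (hd : d ≠ 0) (R : Rep d e1 e2 e3 β γ δ η) : η * δ * η * δ * η = 0 := by
  have h : d • (η * δ * η * δ * η) = 0 := by
    have := R.γβγβ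
    have h2 : η * (d • (δ * η * δ * η)) = 0 := by
      rw [← R.γβγβ, ← mul_assoc, ← mul_assoc, ← mul_assoc, R.r6, zero_mul]
    rw [mul_smul_comm] at h2
    simpa only [mul_assoc] using h2
  exact (smul_eq_zero.1 h).resolve_left hd

variable (K) in
/-- The span of the twenty standard paths. -/
def P (e1 e2 e3 β γ δ η : A) : Submodule K A := Submodule.span K
  {e1, e2, e3, β, γ, δ, η, β * γ, γ * β, δ * η, η * δ, β * δ, η * γ, β * γ * β, γ * β * γ, δ * η * δ, η * δ * η, β * γ * β * γ, δ * η * δ * η, η * δ * η * δ}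

lemma mem0 : e1 ∈ P K e1 e2 e3 β γ δ η := Submodule.subset_span (by simp)
lemma mem1 : e2 ∈ P K e1 e2 e3 β γ δ η := Submodule.subset_span (by simp)
lemma mem2 : e3 ∈ P K e1 e2 e3 β γ δ η := Submodule.subset_span (by simp)
lemma mem3 : β ∈ P K e1 e2 e3 β γ δ η := Submodule.subset_span (by simp)
lemma mem4 : γ ∈ P K e1 e2 e3 β γ δ η := Submodule.subset_span (by simp)
lemma mem5 : δ ∈ P K e1 e2 e3 β γ δ η := Submodule.subset_span (by simp)
lemma mem6 : η ∈ P K e1 e2 e3 β γ δ η := Submodule.subset_span (by simp)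
lemma mem7 : β * γ ∈ P K e1 e2 e3 β γ δ η := Submodule.subset_span (by simp)
lemma mem8 : γ * β ∈ P K e1 e2 e3 β γ δ η := Submodule.subset_span (by simp)
lemma mem9 : δ * η ∈ P K e1 e2 e3 β γ δ η := Submodule.subset_span (by simp)
lemma mem10 : η * δ ∈ P K e1 e2 e3 β γ δ η := Submodule.subset_span (by simp)
lemma mem11 : β * δ ∈ P K e1 e2 e3 β γ δ η := Submodule.subset_span (by simp)
lemma mem12 : η * γ ∈ P K e1 e2 e3 β γ δ η := Submodule.subset_span (by simp)
lemma mem13 : β * γ * β ∈ P K e1 e2 e3 β γ δ η := Submodule.subset_span (by simp)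
lemma mem14 : γ * β * γ ∈ P K e1 e2 e3 β γ δ η := Submodule.subset_span (by simp)
lemma mem15 : δ * η * δ ∈ P K e1 e2 e3 β γ δ η := Submodule.subset_span (by simp)
lemma mem16 : η * δ * η ∈ P K e1 e2 e3 β γ δ η := Submodule.subset_span (by simp)
lemma mem17 : β * γ * β * γ ∈ P K e1 e2 e3 β γ δ η := Submodule.subset_span (by simp)
lemma mem18 : δ * η * δ * η ∈ P K e1 e2 e3 β γ δ η := Submodule.subset_span (by simp)
lemma mem19 : η * δ * η * δ ∈ P K e1 e2 e3 β γ δ η := Submodule.subset_span (by simp)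

lemma P_e1 (hd : d ≠ 0) (R : Rep d e1 e2 e3 β γ δ η) : ∀ p ∈ P K e1 e2 e3 β γ δ η, p * e1 ∈ P K e1 e2 e3 β γ δ η := by
  intro p hp
  change p ∈ (P K e1 e2 e3 β γ δ η).comap (LinearMap.mulRight K e1)
  revert p
  change P K e1 e2 e3 β γ δ η ≤ _
  refine Submodule.span_le.2 ?_
  simp only [Set.insert_subset_iff, Set.singleton_subset_iff, SetLike.mem_coe, Submodule.mem_comap, LinearMap.mulRight_apply]
  refine ⟨?_, ?_, ?_, ?_, ?_, ?_, ?_, ?_, ?_, ?_, ?_, ?_, ?_, ?_, ?_, ?_, ?_, ?_, ?_, ?_⟩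
  · rw [R.h11]; exact mem0
  · rw [R.h21]; exact zero_mem _
  · rw [R.h31]; exact zero_mem _
  · rw [R.z_βe1]; exact zero_mem _
  · rw [R.γr]; exact mem4
  · rw [R.z_δe1]; exact zero_mem _
  · rw [R.z_ηe1]; exact zero_mem _
  · rw [mul_assoc _ γ e1, R.γr]; exact mem7
  · rw [mul_assoc _ β e1, R.z_βe1, mul_zero]; exact zero_mem _
  · rw [mul_assoc _ η e1, R.z_ηe1, mul_zero]; exact zero_mem _
  · rw [mul_assoc _ δ e1, R.z_δe1, mul_zero]; exact zero_mem _
  · rw [mul_assoc _ δ e1, R.z_δe1, mul_zero]; exact zero_mem _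
  · rw [mul_assoc _ γ e1, R.γr]; exact mem12
  · rw [mul_assoc _ β e1, R.z_βe1, mul_zero]; exact zero_mem _
  · rw [mul_assoc _ γ e1, R.γr]; exact mem14
  · rw [mul_assoc _ δ e1, R.z_δe1, mul_zero]; exact zero_mem _
  · rw [mul_assoc _ η e1, R.z_ηe1, mul_zero]; exact zero_mem _
  · rw [mul_assoc _ γ e1, R.γr]; exact mem17
  · rw [mul_assoc _ η e1, R.z_ηe1, mul_zero]; exact zero_mem _
  · rw [mul_assoc _ δ e1, R.z_δe1, mul_zero]; exact zero_mem _
lemma P_e2 (hd : d ≠ 0) (R : Rep d e1 e2 e3 β γ δ η) : ∀ p ∈ P K e1 e2 e3 β γ δ η, p * e2 ∈ P K e1 e2 e3 β γ δ η := by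
  intro p hp
  change p ∈ (P K e1 e2 e3 β γ δ η).comap (LinearMap.mulRight K e2)
  revert p
  change P K e1 e2 e3 β γ δ η ≤ _
  refine Submodule.span_le.2 ?_
  simp only [Set.insert_subset_iff, Set.singleton_subset_iff, SetLike.mem_coe, Submodule.mem_comap, LinearMap.mulRight_apply]
  refine ⟨?_, ?_, ?_, ?_, ?_, ?_, ?_, ?_, ?_, ?_, ?_, ?_, ?_, ?_, ?_, ?_, ?_, ?_, ?_, ?_⟩
  · rw [R.h12]; exact zero_mem _
  · rw [R.h22]; exact mem1
  · rw [R.h32]; exact zero_mem _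
  · rw [R.βr]; exact mem3
  · rw [R.z_γe2]; exact zero_mem _
  · rw [R.z_δe2]; exact zero_mem _
  · rw [R.ηr]; exact mem6
  · rw [mul_assoc _ γ e2, R.z_γe2, mul_zero]; exact zero_mem _
  · rw [mul_assoc _ β e2, R.βr]; exact mem8
  · rw [mul_assoc _ η e2, R.ηr]; exact mem9
  · rw [mul_assoc _ δ e2, R.z_δe2, mul_zero]; exact zero_mem _
  · rw [mul_assoc _ δ e2, R.z_δe2, mul_zero]; exact zero_mem _
  · rw [mul_assoc _ γ e2, R.z_γe2, mul_zero]; exact zero_mem _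
  · rw [mul_assoc _ β e2, R.βr]; exact mem13
  · rw [mul_assoc _ γ e2, R.z_γe2, mul_zero]; exact zero_mem _
  · rw [mul_assoc _ δ e2, R.z_δe2, mul_zero]; exact zero_mem _
  · rw [mul_assoc _ η e2, R.ηr]; exact mem16
  · rw [mul_assoc _ γ e2, R.z_γe2, mul_zero]; exact zero_mem _
  · rw [mul_assoc _ η e2, R.ηr]; exact mem18
  · rw [mul_assoc _ δ e2, R.z_δe2, mul_zero]; exact zero_mem _
lemma P_e3 (hd : d ≠ 0) (R : Rep d e1 e2 e3 β γ δ η) : ∀ p ∈ P K e1 e2 e3 β γ δ η, p * e3 ∈ P K e1 e2 e3 β γ δ η := by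
  intro p hp
  change p ∈ (P K e1 e2 e3 β γ δ η).comap (LinearMap.mulRight K e3)
  revert p
  change P K e1 e2 e3 β γ δ η ≤ _
  refine Submodule.span_le.2 ?_
  simp only [Set.insert_subset_iff, Set.singleton_subset_iff, SetLike.mem_coe, Submodule.mem_comap, LinearMap.mulRight_apply]
  refine ⟨?_, ?_, ?_, ?_, ?_, ?_, ?_, ?_, ?_, ?_, ?_, ?_, ?_, ?_, ?_, ?_, ?_, ?_, ?_, ?_⟩
  · rw [R.h13]; exact zero_mem _
  · rw [R.h23]; exact zero_mem _
  · rw [R.h33]; exact mem2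
  · rw [R.z_βe3]; exact zero_mem _
  · rw [R.z_γe3]; exact zero_mem _
  · rw [R.δr]; exact mem5
  · rw [R.z_ηe3]; exact zero_mem _
  · rw [mul_assoc _ γ e3, R.z_γe3, mul_zero]; exact zero_mem _
  · rw [mul_assoc _ β e3, R.z_βe3, mul_zero]; exact zero_mem _
  · rw [mul_assoc _ η e3, R.z_ηe3, mul_zero]; exact zero_mem _
  · rw [mul_assoc _ δ e3, R.δr]; exact mem10
  · rw [mul_assoc _ δ e3, R.δr]; exact mem11
  · rw [mul_assoc _ γ e3, R.z_γe3, mul_zero]; exact zero_mem _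
  · rw [mul_assoc _ β e3, R.z_βe3, mul_zero]; exact zero_mem _
  · rw [mul_assoc _ γ e3, R.z_γe3, mul_zero]; exact zero_mem _
  · rw [mul_assoc _ δ e3, R.δr]; exact mem15
  · rw [mul_assoc _ η e3, R.z_ηe3, mul_zero]; exact zero_mem _
  · rw [mul_assoc _ γ e3, R.z_γe3, mul_zero]; exact zero_mem _
  · rw [mul_assoc _ η e3, R.z_ηe3, mul_zero]; exact zero_mem _
  · rw [mul_assoc _ δ e3, R.δr]; exact mem19
lemma P_β (hd : d ≠ 0) (R : Rep d e1 e2 e3 β γ δ η) : ∀ p ∈ P K e1 e2 e3 β γ δ η, p * β ∈ P K e1 e2 e3 β γ δ η := by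
  intro p hp
  change p ∈ (P K e1 e2 e3 β γ δ η).comap (LinearMap.mulRight K β)
  revert p
  change P K e1 e2 e3 β γ δ η ≤ _
  refine Submodule.span_le.2 ?_
  simp only [Set.insert_subset_iff, Set.singleton_subset_iff, SetLike.mem_coe, Submodule.mem_comap, LinearMap.mulRight_apply]
  refine ⟨?_, ?_, ?_, ?_, ?_, ?_, ?_, ?_, ?_, ?_, ?_, ?_, ?_, ?_, ?_, ?_, ?_, ?_, ?_, ?_⟩
  · rw [R.βl]; exact mem3
  · rw [R.z_e2β]; exact zero_mem _
  · rw [R.z_e3β]; exact zero_mem _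
  · rw [R.z_ββ]; exact zero_mem _
  · exact mem8
  · rw [R.z_δβ]; exact zero_mem _
  · rw [R.z_ηβ]; exact zero_mem _
  · exact mem13
  · rw [mul_assoc _ β β, R.z_ββ, mul_zero]; exact zero_mem _
  · rw [mul_assoc _ η β, R.z_ηβ, mul_zero]; exact zero_mem _
  · rw [mul_assoc _ δ β, R.z_δβ, mul_zero]; exact zero_mem _
  · rw [mul_assoc _ δ β, R.z_δβ, mul_zero]; exact zero_mem _
  · rw [R.r3]; exact Submodule.smul_mem _ _ mem16
  · rw [mul_assoc _ β β, R.z_ββ, mul_zero]; exact zero_mem _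
  · rw [R.γβγβ]; exact Submodule.smul_mem _ _ mem18
  · rw [mul_assoc _ δ β, R.z_δβ, mul_zero]; exact zero_mem _
  · rw [mul_assoc _ η β, R.z_ηβ, mul_zero]; exact zero_mem _
  · rw [R.βγβγβ]; exact zero_mem _
  · rw [mul_assoc _ η β, R.z_ηβ, mul_zero]; exact zero_mem _
  · rw [mul_assoc _ δ β, R.z_δβ, mul_zero]; exact zero_mem _
lemma P_γ (hd : d ≠ 0) (R : Rep d e1 e2 e3 β γ δ η) : ∀ p ∈ P K e1 e2 e3 β γ δ η, p * γ ∈ P K e1 e2 e3 β γ δ η := by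
  intro p hp
  change p ∈ (P K e1 e2 e3 β γ δ η).comap (LinearMap.mulRight K γ)
  revert p
  change P K e1 e2 e3 β γ δ η ≤ _
  refine Submodule.span_le.2 ?_
  simp only [Set.insert_subset_iff, Set.singleton_subset_iff, SetLike.mem_coe, Submodule.mem_comap, LinearMap.mulRight_apply]
  refine ⟨?_, ?_, ?_, ?_, ?_, ?_, ?_, ?_, ?_, ?_, ?_, ?_, ?_, ?_, ?_, ?_, ?_, ?_, ?_, ?_⟩
  · rw [R.z_e1γ]; exact zero_mem _
  · rw [R.γl]; exact mem4
  · rw [R.z_e3γ]; exact zero_mem _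
  · exact mem7
  · rw [R.z_γγ]; exact zero_mem _
  · rw [R.z_δγ]; exact zero_mem _
  · exact mem12
  · rw [mul_assoc _ γ γ, R.z_γγ, mul_zero]; exact zero_mem _
  · exact mem14
  · rw [R.r2]; exact mem14
  · rw [mul_assoc _ δ γ, R.z_δγ, mul_zero]; exact zero_mem _
  · rw [mul_assoc _ δ γ, R.z_δγ, mul_zero]; exact zero_mem _
  · rw [mul_assoc _ γ γ, R.z_γγ, mul_zero]; exact zero_mem _
  · exact mem17
  · rw [mul_assoc _ γ γ, R.z_γγ, mul_zero]; exact zero_mem _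
  · rw [mul_assoc _ δ γ, R.z_δγ, mul_zero]; exact zero_mem _
  · rw [R.ηδηγ]; exact zero_mem _
  · rw [mul_assoc _ γ γ, R.z_γγ, mul_zero]; exact zero_mem _
  · rw [R.δηδηγ]; exact zero_mem _
  · rw [mul_assoc _ δ γ, R.z_δγ, mul_zero]; exact zero_mem _
lemma P_δ (hd : d ≠ 0) (R : Rep d e1 e2 e3 β γ δ η) : ∀ p ∈ P K e1 e2 e3 β γ δ η, p * δ ∈ P K e1 e2 e3 β γ δ η := by
  intro p hp
  change p ∈ (P K e1 e2 e3 β γ δ η).comap (LinearMap.mulRight K δ)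
  revert p
  change P K e1 e2 e3 β γ δ η ≤ _
  refine Submodule.span_le.2 ?_
  simp only [Set.insert_subset_iff, Set.singleton_subset_iff, SetLike.mem_coe, Submodule.mem_comap, LinearMap.mulRight_apply]
  refine ⟨?_, ?_, ?_, ?_, ?_, ?_, ?_, ?_, ?_, ?_, ?_, ?_, ?_, ?_, ?_, ?_, ?_, ?_, ?_, ?_⟩
  · rw [R.z_e1δ]; exact zero_mem _
  · rw [R.δl]; exact mem5
  · rw [R.z_e3δ]; exact zero_mem _
  · exact mem11
  · rw [R.z_γδ]; exact zero_mem _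
  · rw [R.z_δδ]; exact zero_mem _
  · exact mem10
  · rw [mul_assoc _ γ δ, R.z_γδ, mul_zero]; exact zero_mem _
  · rw [R.r4]; exact Submodule.smul_mem _ _ mem15
  · exact mem15
  · rw [mul_assoc _ δ δ, R.z_δδ, mul_zero]; exact zero_mem _
  · rw [mul_assoc _ δ δ, R.z_δδ, mul_zero]; exact zero_mem _
  · rw [mul_assoc _ γ δ, R.z_γδ, mul_zero]; exact zero_mem _
  · rw [R.βγβδ]; exact zero_mem _
  · rw [mul_assoc _ γ δ, R.z_γδ, mul_zero]; exact zero_mem _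
  · rw [mul_assoc _ δ δ, R.z_δδ, mul_zero]; exact zero_mem _
  · exact mem19
  · rw [mul_assoc _ γ δ, R.z_γδ, mul_zero]; exact zero_mem _
  · rw [R.δηδηδ hd]; exact zero_mem _
  · rw [mul_assoc _ δ δ, R.z_δδ, mul_zero]; exact zero_mem _
lemma P_η (hd : d ≠ 0) (R : Rep d e1 e2 e3 β γ δ η) : ∀ p ∈ P K e1 e2 e3 β γ δ η, p * η ∈ P K e1 e2 e3 β γ δ η := by
  intro p hp
  change p ∈ (P K e1 e2 e3 β γ δ η).comap (LinearMap.mulRight K η)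
  revert p
  change P K e1 e2 e3 β γ δ η ≤ _
  refine Submodule.span_le.2 ?_
  simp only [Set.insert_subset_iff, Set.singleton_subset_iff, SetLike.mem_coe, Submodule.mem_comap, LinearMap.mulRight_apply]
  refine ⟨?_, ?_, ?_, ?_, ?_, ?_, ?_, ?_, ?_, ?_, ?_, ?_, ?_, ?_, ?_, ?_, ?_, ?_, ?_, ?_⟩
  · rw [R.z_e1η]; exact zero_mem _
  · rw [R.z_e2η]; exact zero_mem _
  · rw [R.ηl]; exact mem6
  · rw [R.z_βη]; exact zero_mem _
  · rw [R.z_γη]; exact zero_mem _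
  · exact mem9
  · rw [R.z_ηη]; exact zero_mem _
  · rw [mul_assoc _ γ η, R.z_γη, mul_zero]; exact zero_mem _
  · rw [mul_assoc _ β η, R.z_βη, mul_zero]; exact zero_mem _
  · rw [mul_assoc _ η η, R.z_ηη, mul_zero]; exact zero_mem _
  · exact mem16
  · rw [R.r1]; exact mem13
  · rw [mul_assoc _ γ η, R.z_γη, mul_zero]; exact zero_mem _
  · rw [mul_assoc _ β η, R.z_βη, mul_zero]; exact zero_mem _
  · rw [mul_assoc _ γ η, R.z_γη, mul_zero]; exact zero_mem _
  · exact mem18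
  · rw [mul_assoc _ η η, R.z_ηη, mul_zero]; exact zero_mem _
  · rw [mul_assoc _ γ η, R.z_γη, mul_zero]; exact zero_mem _
  · rw [mul_assoc _ η η, R.z_ηη, mul_zero]; exact zero_mem _
  · rw [R.ηδηδη hd]; exact zero_mem _

lemma q_mem (hd : d ≠ 0) (R : Rep d e1 e2 e3 β γ δ η) {Q : Type} [AddCommGroup Q] [Module K Q] (q : A →ₗ[K] Q)
    (hq : ∀ u v, q (u * v) = q (v * u)) (p : A) (hp : p ∈ P K e1 e2 e3 β γ δ η) :
    q p ∈ Submodule.span K {q e1, q e2, q e3, q (γ * β), q (η * δ), q (β * δ * η * γ)} := by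
  set S := Submodule.span K {q e1, q e2, q e3, q (γ * β), q (η * δ), q (β * δ * η * γ)} with hS
  have hs1 : q (β * γ * β * γ) ∈ S := by
    rw [← R.r1]; exact Submodule.subset_span (by simp)
  have ht3 : q (δ * η * δ * η) ∈ S := by
    have h : d • q (δ * η * δ * η) = q (β * γ * β * γ) := by
      rw [← map_smul, ← R.γβγβ, hq]; simp only [mul_assoc]
    rw [← inv_smul_smul₀ hd (q (δ * η * δ * η)), h]
    exact Submodule.smul_mem _ _ hs1
  change p ∈ S.comap q
  revert p
  change P K e1 e2 e3 β γ δ η ≤ _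
  refine Submodule.span_le.2 ?_
  simp only [Set.insert_subset_iff, Set.singleton_subset_iff, SetLike.mem_coe, Submodule.mem_comap, LinearMap.mulRight_apply]
  refine ⟨?_, ?_, ?_, ?_, ?_, ?_, ?_, ?_, ?_, ?_, ?_, ?_, ?_, ?_, ?_, ?_, ?_, ?_, ?_, ?_⟩
  · exact Submodule.subset_span (by simp)
  · exact Submodule.subset_span (by simp)
  · exact Submodule.subset_span (by simp)
  · have h : β * e2 = β := by rw [R.βr]
    have h2 : e2 * (β) = 0 := by simp only [← mul_assoc, R.z_e2β, zero_mul]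
    rw [← h, hq, h2, map_zero]; exact zero_mem _
  · have h : γ * e1 = γ := by rw [R.γr]
    have h2 : e1 * (γ) = 0 := by simp only [← mul_assoc, R.z_e1γ, zero_mul]
    rw [← h, hq, h2, map_zero]; exact zero_mem _
  · have h : δ * e3 = δ := by rw [R.δr]
    have h2 : e3 * (δ) = 0 := by simp only [← mul_assoc, R.z_e3δ, zero_mul]
    rw [← h, hq, h2, map_zero]; exact zero_mem _
  · have h : η * e2 = η := by rw [R.ηr]
    have h2 : e2 * (η) = 0 := by simp only [← mul_assoc, R.z_e2η, zero_mul]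
    rw [← h, hq, h2, map_zero]; exact zero_mem _
  · rw [hq]; exact Submodule.subset_span (by simp)
  · exact Submodule.subset_span (by simp)
  · rw [hq]; exact Submodule.subset_span (by simp)
  · exact Submodule.subset_span (by simp)
  · have h : β * δ * e3 = β * δ := by rw [mul_assoc _ δ e3, R.δr]
    have h2 : e3 * (β * δ) = 0 := by simp only [← mul_assoc, R.z_e3β, zero_mul]
    rw [← h, hq, h2, map_zero]; exact zero_mem _
  · have h : η * γ * e1 = η * γ := by rw [mul_assoc _ γ e1, R.γr]
    have h2 : e1 * (η * γ) = 0 := by simp only [← mul_assoc, R.z_e1η, zero_mul]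
    rw [← h, hq, h2, map_zero]; exact zero_mem _
  · have h : β * γ * β * e2 = β * γ * β := by rw [mul_assoc _ β e2, R.βr]
    have h2 : e2 * (β * γ * β) = 0 := by simp only [← mul_assoc, R.z_e2β, zero_mul]
    rw [← h, hq, h2, map_zero]; exact zero_mem _
  · have h : γ * β * γ * e1 = γ * β * γ := by rw [mul_assoc _ γ e1, R.γr]
    have h2 : e1 * (γ * β * γ) = 0 := by simp only [← mul_assoc, R.z_e1γ, zero_mul]
    rw [← h, hq, h2, map_zero]; exact zero_mem _
  · have h : δ * η * δ * e3 = δ * η * δ := by rw [mul_assoc _ δ e3, R.δr]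
    have h2 : e3 * (δ * η * δ) = 0 := by simp only [← mul_assoc, R.z_e3δ, zero_mul]
    rw [← h, hq, h2, map_zero]; exact zero_mem _
  · have h : η * δ * η * e2 = η * δ * η := by rw [mul_assoc _ η e2, R.ηr]
    have h2 : e2 * (η * δ * η) = 0 := by simp only [← mul_assoc, R.z_e2η, zero_mul]
    rw [← h, hq, h2, map_zero]; exact zero_mem _
  · exact hs1
  · exact ht3
  · rw [mul_assoc, mul_assoc, hq, ← mul_assoc]; exact ht3
end Rep

section main
variable (K : Type) [Field K] (d : K)

lemma rep : Rep d (F1 K d) (F2 K d) (F3 K d) (Bb K d) (Gg K d) (Dd K d) (Hh K d) where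
  h11 := r_idem1 K d
  h22 := r_idem2 K d
  h33 := r_idem3 K d
  h12 := r_orth12 K d
  h21 := r_orth21 K d
  h13 := r_orth13 K d
  h31 := r_orth31 K d
  h23 := r_orth23 K d
  h32 := r_orth32 K d
  βl := r_bb_left K d
  βr := r_bb_right K d
  γl := r_gg_left K d
  γr := r_gg_right K d
  δl := r_dd_left K d
  δr := r_dd_right K d
  ηl := r_hh_left K d
  ηr := r_hh_right K d
  hs := r_sum_idem K d
  r1 := r_rel1 K d
  r2 := r_rel2 K d
  r3 := r_rel3 K d
  r4 := r_rel4 K d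
  r5 := r_rel5 K d
  r6 := r_rel6 K d

lemma mem_P (hd : d ≠ 0) (x : Bd K d) : x ∈ Rep.P K (F1 K d) (F2 K d) (F3 K d) (Bb K d) (Gg K d) (Dd K d) (Hh K d) := by
  have key : ∀ y : FreeAlgebra K Gen3, ∀ p ∈ Rep.P K (F1 K d) (F2 K d) (F3 K d) (Bb K d) (Gg K d) (Dd K d) (Hh K d),
      p * RingQuot.mkAlgHom K (Rel3 K d) y ∈ Rep.P K (F1 K d) (F2 K d) (F3 K d) (Bb K d) (Gg K d) (Dd K d) (Hh K d) := by
    intro y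
    induction y using FreeAlgebra.induction with
    | grade0 r =>
      intro p hp
      rw [AlgHom.commutes, ← Algebra.commutes, ← Algebra.smul_def]
      exact Submodule.smul_mem _ _ hp
    | grade1 g =>
      cases g
      · exact Rep.P_e1 hd (rep K d)
      · exact Rep.P_e2 hd (rep K d)
      · exact Rep.P_e3 hd (rep K d)
      · exact Rep.P_β hd (rep K d)
      · exact Rep.P_γ hd (rep K d)
      · exact Rep.P_δ hd (rep K d)
      · exact Rep.P_η hd (rep K d)
    | mul a b ha hb =>
      intro p hp
      rw [map_mul, ← mul_assoc]
      exact hb _ (ha _ hp)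
    | add a b ha hb =>
      intro p hp
      rw [map_add, mul_add]
      exact add_mem (ha _ hp) (hb _ hp)
  obtain ⟨y, rfl⟩ := RingQuot.mkAlgHom_surjective K (Rel3 K d) x
  have h1 : (1 : Bd K d) ∈ Rep.P K (F1 K d) (F2 K d) (F3 K d) (Bb K d) (Gg K d) (Dd K d) (Hh K d) := by
    rw [← r_sum_idem K d]
    exact add_mem (add_mem Rep.mem0 Rep.mem1) Rep.mem2
  have := key y 1 h1
  rwa [one_mul] at this

lemma comm_mem (u v : Bd K d) : u * v - v * u ∈ comm3 K d :=
  Submodule.subset_span ⟨u, v, rfl⟩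

/-- Standard combination of the six cocenter representatives. -/
noncomputable def comb (a1 a2 a3 b c t : K) : Bd K d :=
  a1 • F1 K d + a2 • F2 K d + a3 • F3 K d + b • (Gg K d * Bb K d) + c • (Hh K d * Dd K d)
    + t • S1 K d

lemma exists_comb (hd : d ≠ 0) (x : Bd K d) : ∃ a1 a2 a3 b c t : K,
    x - comb K d a1 a2 a3 b c t ∈ comm3 K d := by
  have h := Rep.q_mem hd (rep K d) (comm3 K d).mkQ (fun u v => by
    rw [← sub_eq_zero, ← map_sub, Submodule.mkQ_apply, Submodule.Quotient.mk_eq_zero]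
    exact comm_mem K d u v) x (mem_P K d hd x)
  simp only [Submodule.mem_span_insert, Submodule.mem_span_singleton] at h
  obtain ⟨a1, _, ⟨a2, _, ⟨a3, _, ⟨b, _, ⟨c, _, ⟨t, rfl⟩, rfl⟩, rfl⟩, rfl⟩, rfl⟩, h⟩ := h
  refine ⟨a1, a2, a3, b, c, t, ?_⟩
  rw [← Submodule.Quotient.mk_eq_zero, ← Submodule.mkQ_apply, map_sub, h, sub_eq_zero]
  simp only [comb, S1, map_add, map_smul]
  abel

/-- The trace with values in `RR`. -/
noncomputable def tau : Bd K d →ₗ[K] RR K d :=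
  Matrix.traceLinearMap (Fin 3) K (RR K d) ∘ₗ (Phi K d).toLinearMap

lemma tau_apply (x : Bd K d) : tau K d x = (Phi K d x).trace := rfl

lemma tau_comm (x : Bd K d) (hx : x ∈ comm3 K d) : tau K d x = 0 := by
  change x ∈ LinearMap.ker (tau K d)
  revert x
  change comm3 K d ≤ _
  refine Submodule.span_le.2 ?_
  rintro _ ⟨u, v, rfl⟩
  change tau K d _ = 0
  rw [tau_apply, map_sub, map_mul, map_mul, Matrix.trace_sub, Matrix.trace_mul_comm, sub_self]

lemma chi_comm (x : Bd K d) (hx : x ∈ comm3 K d) : Chi K d x = 0 := by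
  change x ∈ LinearMap.ker (Chi K d).toLinearMap
  revert x
  change comm3 K d ≤ _
  refine Submodule.span_le.2 ?_
  rintro _ ⟨u, v, rfl⟩
  change Chi K d _ = 0
  rw [map_sub, map_mul, map_mul, mul_comm, sub_self]

lemma tau_comb (a1 a2 a3 b c t : K) : tau K d (comb K d a1 a2 a3 b c t) =
    ⟨a1 + a2 + a3, 0, 0, b, 0, c, 0, 0, d * t⟩ := by
  simp only [tau_apply, comb, S1, map_add, map_smul, map_mul, Phi_F1, Phi_F2, Phi_F3, Phi_Bb,
    Phi_Gg, Phi_Dd, Phi_Hh, matGen, Matrix.single_mul_single_same, Matrix.trace_add,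
    Matrix.trace_smul, Matrix.trace_single_eq_same]
  ext <;> simp [RR.B, RR.L]
  ring

lemma chi_comb (a1 a2 a3 b c t : K) : Chi K d (comb K d a1 a2 a3 b c t) = (a1, a2, a3) := by
  simp only [comb, S1, map_add, map_smul, map_mul, Chi_F1, Chi_F2, Chi_F3, Chi_Bb,
    Chi_Gg, Chi_Dd, Chi_Hh, chGen]
  simp

lemma comb_mem_iff (hd : d ≠ 0) (a1 a2 a3 b c t : K) : comb K d a1 a2 a3 b c t ∈ comm3 K d ↔
    a1 = 0 ∧ a2 = 0 ∧ a3 = 0 ∧ b = 0 ∧ c = 0 ∧ t = 0 := by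
  constructor
  · intro h
    have h1 := chi_comm K d _ h
    have h2 := tau_comm K d _ h
    rw [chi_comb] at h1
    rw [tau_comb] at h2
    have hb := congrArg RR.b2 h2
    have hc := congrArg RR.l2 h2
    have ht := congrArg RR.s h2
    simp only [Prod.mk_eq_zero] at h1
    simp [hd] at hb hc ht
    exact ⟨h1.1, h1.2.1, h1.2.2, hb, hc, ht⟩
  · rintro ⟨rfl, rfl, rfl, rfl, rfl, rfl⟩
    simp [comb]

lemma mem_comm_iff (hd : d ≠ 0) (x : Bd K d) : x ∈ comm3 K d ↔
    Chi K d x = 0 ∧ (tau K d x).b2 = 0 ∧ (tau K d x).l2 = 0 ∧ (tau K d x).s = 0 := by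
  constructor
  · intro h
    rw [chi_comm K d _ h, tau_comm K d _ h]
    simp
  · rintro ⟨h1, hb, hc, ht⟩
    obtain ⟨a1, a2, a3, b, c, t, h⟩ := exists_comb K d hd x
    have g1 := chi_comm K d _ h
    have g2 := tau_comm K d _ h
    rw [map_sub, chi_comb, sub_eq_zero] at g1
    rw [map_sub, tau_comb, sub_eq_zero] at g2
    rw [g1] at h1
    rw [g2] at hb hc ht
    simp only [Prod.mk_eq_zero] at h1
    simp [hd] at hb hc ht
    have := (comb_mem_iff K d hd a1 a2 a3 b c t).2 ⟨h1.1, h1.2.1, h1.2.2, hb, hc, ht⟩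
    simpa using add_mem h this

lemma T1_iff [CharP K 2] (hd : d ≠ 0) (x : Bd K d) (a1 a2 a3 b c t : K)
    (h : x - comb K d a1 a2 a3 b c t ∈ comm3 K d) :
    x ∈ T1B K d ↔ a1 = 0 ∧ a2 = 0 ∧ a3 = 0 ∧ d * b ^ 2 + c ^ 2 = 0 := by
  have two : (2 : K) = 0 := CharTwo.two_eq_zero
  have two' : (2 : RR K d) = 0 := by
    have := congrArg (algebraMap K (RR K d)) two
    rwa [map_ofNat, map_zero] at this
  have g1 := chi_comm K d _ h
  have g2 := tau_comm K d _ h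
  rw [map_sub, chi_comb, sub_eq_zero] at g1
  rw [map_sub, tau_comb, sub_eq_zero] at g2
  have sq : tau K d (x ^ 2) = tau K d x ^ 2 := by
    rw [tau_apply, tau_apply, map_pow, pow_two]
    generalize Phi K d x = M
    simp only [Matrix.trace_fin_three, Matrix.mul_apply, Fin.sum_univ_three]
    linear_combination (M 0 1 * M 1 0 + M 0 2 * M 2 0 + M 1 2 * M 2 1
      - M 0 0 * M 1 1 - M 0 0 * M 2 2 - M 1 1 * M 2 2) * two'
  change x ^ 2 ∈ comm3 K d ↔ _
  rw [mem_comm_iff K d hd, sq, map_pow, g1, g2, pow_two (⟨_,_,_,_,_,_,_,_,_⟩ : RR K d)]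
  have e1 : (a1 + a2 + a3) * b + b * (a1 + a2 + a3) = 0 := by
    linear_combination (a1 + a2 + a3) * b * two
  have e2 : (a1 + a2 + a3) * c + c * (a1 + a2 + a3) = 0 := by
    linear_combination (a1 + a2 + a3) * c * two
  have e3 : (a1 + a2 + a3) * (d * t) + d * (b * b + b * c + c * b) + c * c +
      d * t * (a1 + a2 + a3) = d * b ^ 2 + c ^ 2 := by
    linear_combination ((a1 + a2 + a3) * (d * t) + d * b * c) * two
  simp [e1, e2, e3, and_assoc]

/-- The generic membership computation. -/
lemma mem_sup_iff (hd : d ≠ 0) (x : Bd K d) (a1 a2 a3 b c t : K)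
    (h : x - comb K d a1 a2 a3 b c t ∈ comm3 K d) (W : Submodule K (Bd K d)) :
    x ∈ comm3 K d ⊔ W ↔ ∃ y ∈ W, comb K d a1 a2 a3 b c t - y ∈ comm3 K d := by
  rw [Submodule.mem_sup]
  constructor
  · rintro ⟨u, hu, y, hy, rfl⟩
    refine ⟨y, hy, ?_⟩
    have := sub_mem hu h
    convert this using 1
    abel
  · rintro ⟨y, hy, h2⟩
    exact ⟨x - y, by simpa using add_mem h h2, y, hy, by abel⟩

lemma comb_sub (a1 a2 a3 b c t e r s : K) : comb K d a1 a2 a3 b c t -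
    (r • S1 K d + s • (Gg K d * Bb K d + e • (Hh K d * Dd K d))) =
    comb K d a1 a2 a3 (b - s) (c - s * e) (t - r) := by
  simp only [comb]
  module

lemma comb_sub' (a1 a2 a3 b c t r : K) : comb K d a1 a2 a3 b c t -
    r • S1 K d = comb K d a1 a2 a3 b c (t - r) := by
  simp only [comb]
  module

lemma map_sup (W : Submodule K (Bd K d)) :
    (comm3 K d ⊔ W).map (comm3 K d).mkQ = W.map (comm3 K d).mkQ := by
  rw [Submodule.map_sup, Submodule.mkQ_map_self, bot_sup_eq]

end main
end QT3

open QT3 in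
/-- char K = 2.  If d = e² for some e ∈ K then
T₁(B(d)) = [B(d),B(d)] + K·s₁ + K·(γβ + e·ηδ) and dim_K T₁(B(d))/[B(d),B(d)] = 2.
If d is not a square in K then T₁(B(d)) = [B(d),B(d)] + K·s₁ and
dim_K T₁(B(d))/[B(d),B(d)] = 1. -/
theorem statement18 (K : Type) [Field K] [CharP K 2] (d : K) (hd0 : d ≠ 0) (hd1 : d ≠ 1) :
    (∀ e : K, d = e ^ 2 →
      (T1B K d : Set (Bd K d)) =
        ↑(comm3 K d ⊔ Submodule.span K
          {S1 K d, Gg K d * Bb K d + e • (Hh K d * Dd K d)}) ∧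
      Module.finrank K
        ((comm3 K d ⊔ Submodule.span K
          {S1 K d, Gg K d * Bb K d + e • (Hh K d * Dd K d)}).map (comm3 K d).mkQ) = 2) ∧
    (¬ IsSquare d →
      (T1B K d : Set (Bd K d)) =
        ↑(comm3 K d ⊔ Submodule.span K {S1 K d}) ∧
      Module.finrank K
        ((comm3 K d ⊔ Submodule.span K {S1 K d}).map (comm3 K d).mkQ) = 1) := by
  refine ⟨fun e he => ⟨?_, ?_⟩, fun hns => ⟨?_, ?_⟩⟩
  · ext x
    obtain ⟨a1, a2, a3, b, c, t, h⟩ := exists_comb K d hd0 x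
    rw [T1_iff K d hd0 x a1 a2 a3 b c t h, SetLike.mem_coe, mem_sup_iff K d hd0 x a1 a2 a3 b c t h]
    have two : (2 : K) = 0 := CharTwo.two_eq_zero
    constructor
    · rintro ⟨h1, h2, h3, h4⟩
      have h5 : (c - b * e) ^ 2 = 0 := by
        rw [he] at h4
        linear_combination h4 - b * c * e * two
      refine ⟨_, Submodule.mem_span_pair.2 ⟨t, b, rfl⟩, ?_⟩
      rw [comb_sub, comb_mem_iff K d hd0]
      exact ⟨h1, h2, h3, sub_self _, pow_eq_zero_iff two_ne_zero |>.1 h5, sub_self _⟩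
    · rintro ⟨y, hy, h2⟩
      obtain ⟨r, s, rfl⟩ := Submodule.mem_span_pair.1 hy
      rw [comb_sub, comb_mem_iff K d hd0] at h2
      obtain ⟨h1, h2, h3, h4, h5, -⟩ := h2
      refine ⟨h1, h2, h3, ?_⟩
      rw [sub_eq_zero] at h4 h5
      rw [h4, h5, he]
      linear_combination e ^ 2 * s ^ 2 * two
  · rw [map_sup, Submodule.map_span, Set.image_pair]
    have hli : LinearIndependent K ![(comm3 K d).mkQ (S1 K d),
        (comm3 K d).mkQ (Gg K d * Bb K d + e • (Hh K d * Dd K d))] := by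
      rw [LinearIndependent.pair_iff]
      intro r s h
      rw [← map_smul, ← map_smul, ← map_add, Submodule.mkQ_apply,
        Submodule.Quotient.mk_eq_zero] at h
      have h' := neg_mem h
      rw [← zero_sub] at h'
      have h0 : comb K d 0 0 0 0 0 0 = 0 := by simp [comb]
      rw [← h0, comb_sub, comb_mem_iff K d hd0] at h'
      obtain ⟨-, -, -, h4, -, h6⟩ := h'
      simpa using And.intro h6 h4
    have := finrank_span_eq_card hli
    rwa [Matrix.range_cons, Matrix.range_cons, Matrix.range_empty, Set.union_empty,
      Set.singleton_union, Fintype.card_fin] at this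
  · ext x
    obtain ⟨a1, a2, a3, b, c, t, h⟩ := exists_comb K d hd0 x
    rw [T1_iff K d hd0 x a1 a2 a3 b c t h, SetLike.mem_coe, mem_sup_iff K d hd0 x a1 a2 a3 b c t h]
    have two : (2 : K) = 0 := CharTwo.two_eq_zero
    constructor
    · rintro ⟨h1, h2, h3, h4⟩
      have hb : b = 0 := by
        by_contra hb
        refine hns ⟨c / b, ?_⟩
        field_simp
        linear_combination h4 - c ^ 2 * two
      subst hb
      have hc : c = 0 := by simpa using h4
      refine ⟨_, Submodule.mem_span_singleton.2 ⟨t, rfl⟩, ?_⟩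
      rw [comb_sub', comb_mem_iff K d hd0]
      exact ⟨h1, h2, h3, rfl, hc, sub_self _⟩
    · rintro ⟨y, hy, h2⟩
      obtain ⟨r, rfl⟩ := Submodule.mem_span_singleton.1 hy
      rw [comb_sub', comb_mem_iff K d hd0] at h2
      obtain ⟨h1, h2, h3, h4, h5, -⟩ := h2
      refine ⟨h1, h2, h3, ?_⟩
      rw [h4, h5]; simp
  · rw [map_sup, Submodule.map_span, Set.image_singleton]
    refine finrank_span_singleton ?_
    intro h
    rw [Submodule.mkQ_apply, Submodule.Quotient.mk_eq_zero] at h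
    have h' : comb K d 0 0 0 0 0 1 ∈ comm3 K d := by simpa [comb] using h
    exact one_ne_zero ((comb_mem_iff K d hd0 _ _ _ _ _ _).1 h').2.2.2.2.2
end
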